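/- arXiv:2211.01464 — 3 statements merged into one kernel-verified Lean document; each statement's English description precedes it below -/
import Mathlib

section
/- Let X be a stochastic process on [0,T] with values in ℝ^d. Suppose there exist constants C > 0 and α ∈ (0, 1/d) such that for every ξ = (ξ_1,…,ξ_d) ∈ (ℝ∖{0})^d, all 0 ≤ s < t ≤ T, and every choice of exponents k_l ∈ {0,4} (1 ≤ l ≤ d), one has |E[exp(i⟨ξ, X_t − X_s⟩)]| ≤ C · ∏_{l=1}^d |ξ_l|^{−k_l} (t − s)^{−α k_l}. Then ∫_{ℝ^d} ∫_0^T ∫_0^T |E[exp(i⟨ξ, X_t − X_s⟩)]| ds dt dξ < ∞. -/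
open MeasureTheory Filter Topology Set RealInnerProductSpace

noncomputable section

abbrev Ed (d : ℕ) := EuclideanSpace ℝ (Fin d)

/-- Condition (A1) of the paper: for every m, every collection of frequencies with nonzero
coordinates, every partition `0 = t₀ < t₁ < … < t_m < T` and every choice of exponents
`k_{j,l} ∈ {0,4}`, the characteristic function of the linear combination of increments
satisfies the stated bound. -/
def CondA1 {Ω : Type*} [MeasurableSpace Ω] {d : ℕ} (P : Measure Ω)
    (X : ℝ → Ω → Ed d) (T α θ : ℝ) : Prop :=
  ∃ C : ℝ, 0 < C ∧
    ∀ m : ℕ, 0 < m → ∀ ξ : Fin m → Ed d, (∀ j l, ξ j l ≠ 0) →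
      ∀ t : Fin (m + 1) → ℝ, StrictMono t → t 0 = 0 → t (Fin.last m) < T →
        ∀ k : Fin m → Fin d → ℕ, (∀ j l, k j l = 0 ∨ k j l = 4) →
          ‖∫ ω, Complex.exp (Complex.I * Complex.ofReal
              (∑ j, ⟪ξ j, X (t j.succ) ω - X (t j.castSucc) ω⟫)) ∂P‖ ≤
            C ^ m * (m : ℝ) ^ (α * θ * (m : ℝ)) *
              ∏ j, ∏ l, (|ξ j l| ^ (k j l))⁻¹ *
                ((t j.succ - t j.castSucc) ^ (α * (k j l : ℝ)))⁻¹

/-- Condition (A2) of the paper: moment bounds for the increments. -/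
def CondA2 {Ω : Type*} [MeasurableSpace Ω] {d : ℕ} (P : Measure Ω)
    (X : ℝ → Ω → Ed d) (T α ι : ℝ) : Prop :=
  ∃ C : ℝ, 0 < C ∧
    ∀ p : ℝ, 1 ≤ p → ∀ s t : ℝ, 0 ≤ s → s ≤ t → t ≤ T →
      ∫ ω, ‖X t ω - X s ω‖ ^ p ∂P ≤ C ^ p * p ^ (p * ι) * |t - s| ^ (p * α)

/-- `L` is an occupation density (local time) of the path `u ↦ X u ω` on `[0,T]`:
for every Borel `B ⊆ [0,T]` and Borel `A ⊆ ℝ^d`, the occupation measure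
`τ(A,B) = λ(B ∩ X⁻¹(A))` equals `∫_A L(x,B) dx`. -/
def IsOccDensity {Ω : Type*} [MeasurableSpace Ω] {d : ℕ}
    (X : ℝ → Ω → Ed d) (T : ℝ) (L : Ed d → Set ℝ → Ω → ℝ) (ω : Ω) : Prop :=
  ∀ B : Set ℝ, MeasurableSet B → B ⊆ Icc 0 T →
    ∀ A : Set (Ed d), MeasurableSet A →
      volume (B ∩ {u | X u ω ∈ A}) = ENNReal.ofReal (∫ x in A, L x B ω)

/-- Interpolating between the exponents `0` and `4` gives any decay exponent `β ∈ [0, 4]`. -/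
lemma exists_exponent_bound {α β τ T x : ℝ} (hα : 0 ≤ α) (hτ : 0 < τ) (hτT : τ ≤ T)
    (hβ : 0 ≤ β) (hβ4 : β ≤ 4) (hx : x ≠ 0) :
    ∃ k : ℕ, (k = 0 ∨ k = 4) ∧ (|x| ^ k)⁻¹ * (τ ^ (α * (k : ℝ)))⁻¹ ≤
      (1 + T ^ α) ^ β * (1 + ‖x‖) ^ (-β) * τ ^ (-(α * β)) := by
  have hx' : 0 < |x| := abs_pos.2 hx
  have hτα : 0 < τ ^ α := Real.rpow_pos_of_pos hτ α
  have hle : τ ^ α ≤ T ^ α := Real.rpow_le_rpow hτ.le hτT hα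
  have hTα : 0 < T ^ α := hτα.trans_le hle
  have hrhs : (1 + T ^ α) ^ β * (1 + ‖x‖) ^ (-β) * τ ^ (-(α * β)) =
      ((1 + T ^ α) / ((1 + |x|) * τ ^ α)) ^ β := by
    rw [Real.div_rpow (by positivity) (by positivity), Real.mul_rpow (by positivity) hτα.le,
      ← Real.rpow_mul hτ.le, Real.norm_eq_abs, Real.rpow_neg (by positivity), Real.rpow_neg hτ.le]
    field_simp
  rw [hrhs]
  rcases le_total (|x| * τ ^ α) 1 with h | h
  · refine ⟨0, Or.inl rfl, ?_⟩
    have : 1 ≤ (1 + T ^ α) / ((1 + |x|) * τ ^ α) := by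
      rw [one_le_div (by positivity)]
      linarith
    simpa using Real.one_le_rpow this hβ
  · refine ⟨4, Or.inr rfl, ?_⟩
    have hpow : (|x| ^ 4)⁻¹ * (τ ^ (α * ((4 : ℕ) : ℝ)))⁻¹ = ((|x| * τ ^ α)⁻¹) ^ (4 : ℝ) := by
      rw [Real.rpow_mul hτ.le, Real.rpow_natCast, ← mul_inv, ← mul_pow, ← inv_pow]
      norm_cast
    rw [hpow]
    calc ((|x| * τ ^ α)⁻¹) ^ (4 : ℝ) ≤ ((|x| * τ ^ α)⁻¹) ^ β :=
          Real.rpow_le_rpow_of_exponent_ge (by positivity) (inv_le_one_of_one_le₀ h) hβ4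
      _ ≤ _ := by
          refine Real.rpow_le_rpow (by positivity) ?_ hβ
          rw [inv_eq_one_div, div_le_div_iff₀ (by positivity) (by positivity)]
          nlinarith [mul_le_mul_of_nonneg_left h (hτα.le.trans hle)]

lemma integrable_prod_one_add_norm_rpow {d : ℕ} {β : ℝ} (hβ : 1 < β) :
    Integrable fun ξ : Ed d ↦ ∏ l, (1 + ‖ξ l‖) ^ (-β) := by
  have h : Integrable fun x : ℝ ↦ (1 + ‖x‖) ^ (-β) :=
    integrable_one_add_norm (by simpa using hβ)
  exact (PiLp.volume_preserving_ofLp (Fin d)).integrable_comp_of_integrable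
    (Integrable.fintype_prod fun _ : Fin d ↦ h)

lemma ae_forall_apply_ne_zero (d : ℕ) : ∀ᵐ ξ : Ed d, ∀ l, ξ l ≠ 0 := by
  refine ae_all_iff.2 fun l ↦ ?_
  exact (PiLp.volume_preserving_ofLp (Fin d)).quasiMeasurePreserving.ae
    (Measure.ae_eval_ne (fun _ : Fin d ↦ (volume : Measure ℝ)) l 0)

lemma lintegral_lintegral_abs_sub_rpow_lt_top {γ : ℝ} (hγ : γ < 1) (T : ℝ) :
    ∫⁻ s in Icc 0 T, ∫⁻ t in Icc 0 T, ENNReal.ofReal (|t - s| ^ (-γ)) < ⊤ := by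
  have hint : IntegrableOn (fun u : ℝ ↦ |u| ^ (-γ)) (Icc (-T) T) := by
    have h : LocallyIntegrable (fun u : ℝ ↦ |u| ^ (-γ)) :=
      locallyIntegrable_of_norm_le_rpow (C := 1) (α := γ) (by simp) (by simpa using hγ)
        (ae_of_all _ fun u ↦ by simp [abs_of_nonneg (Real.rpow_nonneg (abs_nonneg u) _)])
        (measurable_norm.pow_const _).aestronglyMeasurable
    exact h.integrableOn_isCompact isCompact_Icc
  have hfin : ∫⁻ u in Icc (-T) T, ENNReal.ofReal (|u| ^ (-γ)) < ⊤ := hint.lintegral_lt_top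
  calc ∫⁻ s in Icc 0 T, ∫⁻ t in Icc 0 T, ENNReal.ofReal (|t - s| ^ (-γ))
      ≤ ∫⁻ s in Icc 0 T, ∫⁻ u in Icc (-T) T, ENNReal.ofReal (|u| ^ (-γ)) := by
        refine setLIntegral_mono' measurableSet_Icc fun s hs ↦ ?_
        rw [← lintegral_indicator measurableSet_Icc, ← lintegral_indicator measurableSet_Icc,
          ← lintegral_sub_right_eq_self ((Icc (-T) T).indicator _) s]
        refine lintegral_mono fun t ↦ ?_
        by_cases ht : t ∈ Icc 0 T
        · rw [indicator_of_mem ht, indicator_of_mem]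
          exact ⟨by linarith [ht.1, hs.2], by linarith [ht.2, hs.1]⟩
        · simp [indicator_of_notMem ht]
    _ < ⊤ := by
        rw [setLIntegral_const]
        exact ENNReal.mul_lt_top hfin measure_Icc_lt_top

/-- under a single-increment version of condition (A1), Berman's integral
is finite, so the local time exists. -/
theorem localTime_existence_integral_finite
    {Ω : Type*} [MeasurableSpace Ω] (P : Measure Ω) [IsProbabilityMeasure P]
    {d : ℕ} (hd : 0 < d) (T : ℝ) (hT : 0 < T)
    (X : ℝ → Ω → Ed d) (hmeas : ∀ t : ℝ, Measurable (X t))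
    (C α : ℝ) (hC : 0 < C) (hα : 0 < α) (hαd : α < 1 / d)
    (hbound : ∀ ξ : Ed d, (∀ l, ξ l ≠ 0) → ∀ s t : ℝ, 0 ≤ s → s < t → t ≤ T →
      ∀ k : Fin d → ℕ, (∀ l, k l = 0 ∨ k l = 4) →
        ‖∫ ω, Complex.exp (Complex.I * Complex.ofReal ⟪ξ, X t ω - X s ω⟫) ∂P‖ ≤
          C * ∏ l, (|ξ l| ^ (k l))⁻¹ * ((t - s) ^ (α * (k l : ℝ)))⁻¹) :
    ∫⁻ ξ : Ed d, ∫⁻ s in Icc (0 : ℝ) T, ∫⁻ t in Icc (0 : ℝ) T,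
        ENNReal.ofReal
          ‖∫ ω, Complex.exp (Complex.I * Complex.ofReal ⟪ξ, X t ω - X s ω⟫) ∂P‖
      < ⊤ := by
  have hd' : (0 : ℝ) < d := Nat.cast_pos.2 hd
  obtain ⟨β, hβ1, hβ⟩ : ∃ β : ℝ, 1 < β ∧ β < min 4 (1 / (α * d)) := by
    refine exists_between (lt_min (by norm_num) ?_)
    rw [lt_div_iff₀ (by positivity), one_mul]
    exact (lt_div_iff₀ hd').1 hαd
  have hβ4 : β ≤ 4 := (hβ.trans_le (min_le_left _ _)).le
  have hγ : α * β * d < 1 := by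
    have := (lt_div_iff₀ (by positivity)).1 (hβ.trans_le (min_le_right _ _))
    linarith
  set M : ℝ := C * ((1 + T ^ α) ^ β) ^ d
  set F : Ed d → ℝ := fun ξ ↦ ∏ l, (1 + ‖ξ l‖) ^ (-β) with hF
  have hF0 (ξ : Ed d) : 0 ≤ F ξ := Finset.prod_nonneg fun l _ ↦ by positivity
  have hM0 : 0 ≤ M := by positivity
  have key_lt (ξ : Ed d) (hξ : ∀ l, ξ l ≠ 0) (s t : ℝ) (hs : 0 ≤ s) (hst : s < t) (ht : t ≤ T) :
      ‖∫ ω, Complex.exp (Complex.I * Complex.ofReal ⟪ξ, X t ω - X s ω⟫) ∂P‖ ≤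
        M * F ξ * |t - s| ^ (-(α * β * d)) := by
    have hτ : 0 < t - s := sub_pos.2 hst
    choose k hk hle using fun l ↦
      exists_exponent_bound hα.le hτ (by linarith : t - s ≤ T) (by linarith) hβ4 (hξ l)
    refine (hbound ξ hξ s t hs hst ht k hk).trans ?_
    calc _ ≤ C * ∏ l, (1 + T ^ α) ^ β * (1 + ‖ξ l‖) ^ (-β) * (t - s) ^ (-(α * β)) := by
          exact mul_le_mul_of_nonneg_left (Finset.prod_le_prod (fun l _ ↦ by positivity)
            fun l _ ↦ hle l) hC.le
      _ = _ := by
          rw [Finset.prod_mul_distrib, Finset.prod_mul_distrib, Finset.prod_const,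
            Finset.prod_const, Finset.card_univ, Fintype.card_fin, ← Real.rpow_mul_natCast hτ.le,
            abs_of_pos hτ, neg_mul]
          ring
  have key (ξ : Ed d) (hξ : ∀ l, ξ l ≠ 0) (s t : ℝ) (hs : s ∈ Icc 0 T) (ht : t ∈ Icc 0 T)
      (hst : t ≠ s) :
      ‖∫ ω, Complex.exp (Complex.I * Complex.ofReal ⟪ξ, X t ω - X s ω⟫) ∂P‖ ≤
        M * F ξ * |t - s| ^ (-(α * β * d)) := by
    rcases hst.lt_or_gt with h | h
    · have := key_lt (-ξ) (by simpa using hξ) t s ht.1 h hs.2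
      have hswap (ω : Ω) : ⟪-ξ, X s ω - X t ω⟫ = ⟪ξ, X t ω - X s ω⟫ := by
        rw [inner_neg_left, ← inner_neg_right, neg_sub]
      simp_rw [hswap] at this
      simpa [hF, abs_sub_comm s t] using this
    · exact key_lt ξ hξ s t hs.1 h ht.2
  set K := ∫⁻ s in Icc 0 T, ∫⁻ t in Icc 0 T, ENNReal.ofReal (|t - s| ^ (-(α * β * d))) with hK
  have hKfin : K < ⊤ := lintegral_lintegral_abs_sub_rpow_lt_top hγ T
  calc _ ≤ ∫⁻ ξ : Ed d, ENNReal.ofReal (M * F ξ) * K := by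
        refine lintegral_mono_ae ?_
        filter_upwards [ae_forall_apply_ne_zero d] with ξ hξ
        rw [hK, ← lintegral_const_mul' _ _ ENNReal.ofReal_ne_top]
        refine setLIntegral_mono' measurableSet_Icc fun s hs ↦ ?_
        rw [← lintegral_const_mul' _ _ ENNReal.ofReal_ne_top]
        refine lintegral_mono_ae ?_
        filter_upwards [ae_restrict_mem measurableSet_Icc,
          ae_restrict_of_ae (Measure.ae_ne volume s)] with t ht hts
        rw [← ENNReal.ofReal_mul (mul_nonneg hM0 (hF0 ξ))]
        exact ENNReal.ofReal_le_ofReal (key ξ hξ s t hs ht hts)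
    _ < ⊤ := by
        rw [lintegral_mul_const' _ _ hKfin.ne]
        exact ENNReal.mul_lt_top
          ((integrable_prod_one_add_norm_rpow hβ1).const_mul M).lintegral_lt_top hKfin
end
end

section
/- Suppose X = (X_t)_{t∈[0,T]} has almost surely continuous sample paths in ℝ^d and satisfies conditions (A1) and (A2) for some α ∈ (0, 1/d), θ ≥ 0 and ι ∈ [0,1]. Then almost surely, for every t ∈ [0,T] the occupation measure A ↦ τ(A,[0,t]) is absolutely continuous with respect to d-dimensional Lebesgue measure, and there is a version L(x,t) of the local time which is almost surely jointly continuous in (x,t) ∈ ℝ^d × [0,T]. -/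
open MeasureTheory Filter Topology Set RealInnerProductSpace

noncomputable section

open scoped ENNReal

section FinIncrements

/-- The consecutive differences `s₀ - a, s₁ - s₀, s₂ - s₁, …` of a tuple. -/
def finIncr {E : Type*} [AddCommGroup E] {m : ℕ} (a : E) (s : Fin m → E) : Fin m → E :=
  fun j => s j - (Fin.cons a s : Fin (m + 1) → E) j.castSucc

/-- The backward differences `s₀ - s₁, s₁ - s₂, …, s_{m-1}` of a tuple. -/
def finDecr {E : Type*} [AddCommGroup E] {m : ℕ} (s : Fin m → E) : Fin m → E :=
  fun j => s j - (Fin.snoc s 0 : Fin (m + 1) → E) j.succ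

theorem measurable_fin_cons {E : Type*} [MeasurableSpace E] {n : ℕ} :
    Measurable fun p : E × (Fin n → E) => (Fin.cons p.1 p.2 : Fin (n + 1) → E) := by
  refine measurable_pi_lambda _ fun j => ?_
  refine Fin.cases ?_ (fun i => ?_) j
  · simpa using measurable_fst
  · simp only [Fin.cons_succ]
    fun_prop

theorem lintegral_fin_succ {E : Type*} [MeasureSpace E] [SigmaFinite (volume : Measure E)] {n : ℕ}
    (f : (Fin (n + 1) → E) → ℝ≥0∞) (hf : Measurable f) :
    ∫⁻ s, f s = ∫⁻ x : E, ∫⁻ s : Fin n → E, f (Fin.cons x s) := by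
  have hmp := (volume_preserving_piFinSuccAbove (fun _ : Fin (n + 1) => E) 0).symm
  rw [← hmp.lintegral_comp_emb (MeasurableEquiv.measurableEmbedding _) f]
  have key : ∀ p : E × (Fin n → E),
      (MeasurableEquiv.piFinSuccAbove (fun _ : Fin (n + 1) => E) 0).symm p
        = (Fin.cons p.1 p.2 : Fin (n + 1) → E) := fun p => by
    simp [MeasurableEquiv.piFinSuccAbove_symm_apply, Fin.insertNthEquiv]
  calc _ = ∫⁻ p : E × (Fin n → E), f (Fin.cons p.1 p.2 : Fin (n + 1) → E) :=
        lintegral_congr fun p => congrArg f (key p)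
    _ = _ := by
        rw [Measure.volume_eq_prod, lintegral_prod (fun p : E × (Fin n → E) => f (Fin.cons p.1 p.2))
          (hf.comp measurable_fin_cons).aemeasurable]

theorem lintegral_fin_prod_eq_prod {E : Type*} [MeasureSpace E]
    [SigmaFinite (volume : Measure E)] {n : ℕ} (f : Fin n → E → ℝ≥0∞)
    (hf : ∀ i, Measurable (f i)) :
    ∫⁻ x : Fin n → E, ∏ i, f i (x i) = ∏ i, ∫⁻ x, f i x := by
  induction n with
  | zero => simp [lintegral_const, volume_pi]
  | succ n ih =>
    have h1 : ∀ g : Fin n → E → ℝ≥0∞, (∀ i, Measurable (g i)) →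
        Measurable fun x : Fin n → E => ∏ i, g i (x i) := fun g hg =>
      Finset.measurable_prod _ fun i _ => (hg _).comp (measurable_pi_apply i)
    rw [lintegral_fin_succ (fun x : Fin (n + 1) → E => ∏ i, f i (x i))
      (Finset.measurable_prod _ fun i _ => (hf _).comp (measurable_pi_apply i)), Fin.prod_univ_succ, ← ih _ fun i => hf i.succ]
    simp only [Fin.prod_univ_succ, Fin.cons_zero, Fin.cons_succ]
    simp_rw [lintegral_const_mul _ (h1 _ fun i => hf i.succ)]
    rw [lintegral_mul_const _ (hf 0)]

theorem measurable_finIncr {E : Type*} [MeasurableSpace E] [AddCommGroup E] [MeasurableSub₂ E]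
    {m : ℕ} (a : E) : Measurable (finIncr a : (Fin m → E) → Fin m → E) := by
  refine measurable_pi_lambda _ fun j => (measurable_pi_apply j).sub ?_
  generalize j.castSucc = k
  refine Fin.cases ?_ (fun i => ?_) k
  · simp
  · simpa using measurable_pi_apply i

theorem lintegral_finIncr {E : Type*} [MeasureSpace E] [SigmaFinite (volume : Measure E)]
    [AddCommGroup E] [MeasurableSub₂ E] [MeasurableAdd E]
    [(volume : Measure E).IsAddRightInvariant] {m : ℕ} (a : E) (f : (Fin m → E) → ℝ≥0∞)
    (hf : Measurable f) : ∫⁻ s, f (finIncr a s) = ∫⁻ s, f s := by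
  induction m generalizing a with
  | zero =>
    congr 1; ext s; congr 1; exact Subsingleton.elim _ _
  | succ n ih =>
    have key : ∀ (x : E) (s : Fin n → E), finIncr a (Fin.cons x s : Fin (n + 1) → E)
        = Fin.cons (x - a) (finIncr x s) := by
      intro x s
      ext j
      refine Fin.cases ?_ (fun i => ?_) j
      · simp [finIncr]
      · simp [finIncr]
    rw [lintegral_fin_succ (fun s => f (finIncr a s)) (hf.comp (measurable_finIncr a)),
      lintegral_fin_succ f hf]
    simp only [key]
    have h2 : ∀ x : E, ∫⁻ y : Fin n → E, f (Fin.cons (x - a) (finIncr x y) : Fin (n + 1) → E)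
        = ∫⁻ y : Fin n → E, f (Fin.cons (x - a) y : Fin (n + 1) → E) := fun x =>
      ih x (fun y => f (Fin.cons (x - a) y))
        (hf.comp (measurable_fin_cons.comp measurable_prodMk_left))
    simp only [h2]
    exact lintegral_sub_right_eq_self
      (fun x : E => ∫⁻ y : Fin n → E, f (Fin.cons x y : Fin (n + 1) → E)) a

theorem lintegral_comp_perm {E : Type*} [MeasureSpace E] [SigmaFinite (volume : Measure E)]
    {m : ℕ} (σ : Equiv.Perm (Fin m)) (f : (Fin m → E) → ℝ≥0∞) :
    ∫⁻ s : Fin m → E, f (fun j => s (σ j)) = ∫⁻ s, f s := by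
  have h := volume_measurePreserving_piCongrLeft (fun _ : Fin m => E) σ.symm
  rw [← h.lintegral_comp_emb (MeasurableEquiv.measurableEmbedding _) f]
  congr 1; ext s; congr 1; ext j
  have := Equiv.piCongrLeft_apply_apply (fun _ : Fin m => E) σ.symm s (σ j)
  rw [MeasurableEquiv.coe_piCongrLeft]
  simpa using this.symm

theorem lintegral_finDecr {E : Type*} [MeasureSpace E] [SigmaFinite (volume : Measure E)]
    [AddCommGroup E] [MeasurableSub₂ E] [MeasurableAdd E]
    [(volume : Measure E).IsAddRightInvariant] {m : ℕ} (f : (Fin m → E) → ℝ≥0∞)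
    (hf : Measurable f) : ∫⁻ s, f (finDecr s) = ∫⁻ s, f s := by
  have key : ∀ s : Fin m → E, finDecr s
      = fun j => finIncr 0 (fun i => s (Fin.revPerm i)) (Fin.revPerm j) := by
    intro s
    ext j
    simp only [finDecr, finIncr, Fin.revPerm_apply, Fin.rev_rev]
    congr 1
    rw [← Fin.rev_succ]
    generalize j.succ = k
    refine Fin.lastCases ?_ (fun i => ?_) k
    · simp
    · simp [Fin.rev_castSucc]
  simp only [key]
  rw [lintegral_comp_perm Fin.revPerm (fun s => f fun j => finIncr 0 s (Fin.revPerm j)),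
    lintegral_finIncr 0 (fun s => f fun j => s (Fin.revPerm j)) (hf.comp (by fun_prop)),
    lintegral_comp_perm Fin.revPerm f]

theorem finDecr_apply {ι : Type*} {m : ℕ} (ξ : Fin m → ι → ℝ) (j : Fin m) (l : ι) :
    finDecr ξ j l = finDecr (fun i => ξ i l) j := by
  simp only [finDecr, Pi.sub_apply]
  congr 1
  generalize j.succ = k
  refine Fin.lastCases ?_ (fun i => ?_) k <;> simp

theorem sum_finDecr_mul {m : ℕ} (ξ y : Fin m → ℝ) :
    ∑ j, finDecr ξ j * y j = ∑ j, ξ j * finIncr 0 y j := by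
  have h := (Fin.sum_univ_succ fun j : Fin (m + 1) =>
    (Fin.snoc ξ 0 : Fin (m + 1) → ℝ) j * (Fin.cons 0 y : Fin (m + 1) → ℝ) j).symm.trans
    (Fin.sum_univ_castSucc _)
  simp only [Fin.cons_zero, Fin.cons_succ, Fin.snoc_castSucc, Fin.snoc_last, mul_zero, zero_mul,
    zero_add, add_zero] at h
  simp only [finDecr, finIncr, sub_mul, mul_sub, Finset.sum_sub_distrib]
  rw [h]

end FinIncrements

section SortedTimes

theorem strictMono_cons_zero {m : ℕ} {s : Fin m → ℝ} (hs : StrictMono s) (h0 : ∀ j, 0 < s j) :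
    StrictMono (Fin.cons 0 s : Fin (m + 1) → ℝ) := by
  intro a b
  refine Fin.cases ?_ (fun a => ?_) a <;> refine Fin.cases ?_ (fun b => ?_) b
  · simp
  · simpa using h0 b
  · simp
  · simpa using @hs a b

theorem finIncr_mem_Ioo {m : ℕ} {T : ℝ} {s : Fin m → ℝ} (hs : StrictMono s)
    (hT : ∀ j, s j ∈ Ioo 0 T) (j : Fin m) : finIncr 0 s j ∈ Ioo 0 T := by
  have h := strictMono_cons_zero hs fun j => (hT j).1
  have h1 := h (Fin.castSucc_lt_succ (i := j))
  have h2 := h.monotone (Fin.zero_le j.castSucc)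
  simp only [Fin.cons_succ, Fin.cons_zero] at h1 h2
  simp only [finIncr, mem_Ioo]
  exact ⟨by linarith, by linarith [(hT j).2]⟩

theorem ae_injective_fin {m : ℕ} : ∀ᵐ s : Fin m → ℝ, Function.Injective s := by
  have h : ∀ i j : Fin m, i ≠ j → ∀ᵐ s : Fin m → ℝ, s i ≠ s j := by
    intro i j hij
    let φ : (Fin m → ℝ) →ₗ[ℝ] ℝ := LinearMap.proj (R := ℝ) (φ := fun _ : Fin m => ℝ) i - LinearMap.proj j
    have hφ : LinearMap.ker φ ≠ ⊤ := by
      intro h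
      have : φ (Pi.single i 1) = 0 := by
        rw [← LinearMap.mem_ker, h]; trivial
      simp [φ, hij.symm] at this
    have h0 := Measure.addHaar_submodule (volume : Measure (Fin m → ℝ)) (LinearMap.ker φ) hφ
    rw [ae_iff]
    convert h0 using 2
    ext s
    simp [φ, sub_eq_zero]
  have h' : ∀ᵐ s : Fin m → ℝ, ∀ i j : Fin m, i ≠ j → s i ≠ s j := by
    refine ae_all_iff.2 fun i => ae_all_iff.2 fun j => ?_
    by_cases hij : i = j
    · simp [hij]
    · filter_upwards [h i j hij] with s hs _ using hs
  filter_upwards [h'] with s hs i j hij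
  by_contra hne
  exact hs i j hne hij

/-- A symmetric function that is bounded on ordered tuples by a product over the consecutive
increments has an integral over the cube bounded by a power of a one-dimensional integral. -/
theorem setLIntegral_cube_le_of_symmetric {m : ℕ} {T : ℝ} (Φ : (Fin m → ℝ) → ℝ≥0∞)
    (hsymm : ∀ (σ : Equiv.Perm (Fin m)) (s : Fin m → ℝ), Φ (fun j => s (σ j)) = Φ s)
    (c : ℝ≥0∞) (k : ℝ → ℝ≥0∞) (hk : Measurable k)
    (hbound : ∀ s : Fin m → ℝ, StrictMono s → (∀ j, s j ∈ Ioo 0 T) →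
      Φ s ≤ c * ∏ j, k (finIncr 0 s j)) :
    ∫⁻ s in Set.univ.pi fun _ : Fin m => Ioo 0 T, Φ s ≤
      Fintype.card (Equiv.Perm (Fin m)) * (c * (∫⁻ r in Ioo 0 T, k r) ^ m) := by
  set k' : ℝ → ℝ≥0∞ := (Ioo 0 T).indicator k with hk'
  have hk'm : Measurable k' := hk.indicator measurableSet_Ioo
  set B : (Fin m → ℝ) → ℝ≥0∞ := fun s => c * ∏ j, k' (finIncr 0 s j) with hB
  have hprod : Measurable fun s : Fin m → ℝ => ∏ j, k' (s j) :=
    Finset.measurable_prod _ fun i _ => hk'm.comp (measurable_pi_apply i)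
  have hBm : Measurable B := (hprod.comp (measurable_finIncr 0)).const_mul c
  have hBint : ∫⁻ s, B s = c * (∫⁻ r in Ioo 0 T, k r) ^ m := by
    have h1 : Measurable fun s : Fin m → ℝ => ∏ j, k' (finIncr 0 s j) :=
      hprod.comp (measurable_finIncr 0)
    rw [hB, lintegral_const_mul _ h1,
      lintegral_finIncr 0 (fun s : Fin m → ℝ => ∏ j, k' (s j)) hprod,
      lintegral_fin_prod_eq_prod (fun _ => k') (fun _ => hk'm)]
    simp [hk', lintegral_indicator measurableSet_Ioo]
  calc ∫⁻ s in Set.univ.pi fun _ : Fin m => Ioo 0 T, Φ s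
      ≤ ∫⁻ s in Set.univ.pi fun _ : Fin m => Ioo 0 T,
          ∑ σ : Equiv.Perm (Fin m), B (fun j => s (σ j)) := by
        refine lintegral_mono_ae ?_
        filter_upwards [ae_restrict_mem (MeasurableSet.univ_pi fun _ => measurableSet_Ioo),
          ae_restrict_of_ae ae_injective_fin] with s hs hinj
        have hs' : ∀ j, s j ∈ Ioo 0 T := fun j => hs j (mem_univ j)
        have hmono : StrictMono fun j => s (Tuple.sort s j) :=
          (Tuple.monotone_sort s).strictMono_of_injective (hinj.comp (Tuple.sort s).injective)
        have hmem := finIncr_mem_Ioo hmono fun j => hs' _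
        calc Φ s = Φ (fun j => s (Tuple.sort s j)) := (hsymm _ _).symm
          _ ≤ B (fun j => s (Tuple.sort s j)) := by
            refine (hbound _ hmono fun j => hs' _).trans (le_of_eq ?_)
            simp only [hB, hk']
            congr 1
            exact Finset.prod_congr rfl fun j _ => (indicator_of_mem (hmem j) _).symm
          _ ≤ _ := Finset.single_le_sum (f := fun σ : Equiv.Perm (Fin m) => B (fun j => s (σ j)))
            (fun _ _ => zero_le) (Finset.mem_univ _)
    _ ≤ ∫⁻ s : Fin m → ℝ, ∑ σ : Equiv.Perm (Fin m), B (fun j => s (σ j)) :=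
        setLIntegral_le_lintegral _ _
    _ = ∑ σ : Equiv.Perm (Fin m), ∫⁻ s : Fin m → ℝ, B (fun j => s (σ j)) :=
        lintegral_finsetSum _ fun σ _ => hBm.comp (by fun_prop)
    _ = _ := by simp [lintegral_comp_perm, hBint]

end SortedTimes

section FourierBound

theorem lintegral_weight_le {q M r : ℝ} (hq0 : 0 ≤ q) (hq1 : q ≤ 1) (hr : 0 < r) (hM : 1 ≤ M)
    (hrM : r ≤ M) :
    ∫⁻ x : ℝ, ENNReal.ofReal ((1 + |x|) ^ q * ((1 + r * |x|) ^ 4)⁻¹) ≤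
      ENNReal.ofReal ((M / r) ^ q * (r⁻¹ * ∫ x : ℝ, (1 + ‖x‖) ^ (-3 : ℝ))) := by
  have hint : Integrable fun x : ℝ => (1 + ‖x‖) ^ (-3 : ℝ) :=
    integrable_one_add_norm (by simp)
  have hint' : Integrable fun x : ℝ => (1 + ‖r * x‖) ^ (-3 : ℝ) :=
    hint.comp_mul_left' hr.ne'
  have heq : (M / r) ^ q * (r⁻¹ * ∫ x : ℝ, (1 + ‖x‖) ^ (-3 : ℝ))
      = ∫ x : ℝ, (M / r) ^ q * (1 + ‖r * x‖) ^ (-3 : ℝ) := by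
    rw [integral_const_mul, Measure.integral_comp_mul_left (fun x : ℝ => (1 + ‖x‖) ^ (-3 : ℝ)),
      abs_of_pos (inv_pos.2 hr), smul_eq_mul]
  rw [heq, ofReal_integral_eq_lintegral_ofReal (hint'.const_mul _)
    (Eventually.of_forall fun x => by positivity)]
  refine lintegral_mono fun x => ENNReal.ofReal_le_ofReal ?_
  have hx : ‖r * x‖ = r * |x| := by rw [norm_mul, Real.norm_of_nonneg hr.le, Real.norm_eq_abs]
  rw [hx]
  have hy : 0 < 1 + r * |x| := by positivity
  have h1 : 1 + |x| ≤ (M / r) * (1 + r * |x|) := by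
    have e : (M / r) * (1 + r * |x|) = M / r + M * |x| := by field_simp
    have : 1 ≤ M / r := (one_le_div hr).2 hrM
    rw [e]
    nlinarith [abs_nonneg x]
  have h2 : (1 + |x|) ^ q ≤ (M / r) ^ q * (1 + r * |x|) ^ q := by
    rw [← Real.mul_rpow (by positivity) hy.le]
    exact Real.rpow_le_rpow (by positivity) h1 hq0
  have h3 : (1 + r * |x|) ^ q ≤ 1 + r * |x| := by
    conv_rhs => rw [← Real.rpow_one (1 + r * |x|)]
    exact Real.rpow_le_rpow_of_exponent_le (by nlinarith [abs_nonneg x]) hq1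
  have h4 : (1 + r * |x|) ^ (-3 : ℝ) = (1 + r * |x|) * ((1 + r * |x|) ^ 4)⁻¹ := by
    rw [Real.rpow_neg hy.le, show (3 : ℝ) = ((3 : ℕ) : ℝ) by norm_num, Real.rpow_natCast]
    field_simp
  rw [h4, ← mul_assoc]
  refine mul_le_mul_of_nonneg_right (h2.trans ?_) (by positivity)
  exact mul_le_mul_of_nonneg_left h3 (by positivity)

theorem prod_finDecr_le {E : Type*} [AddCommGroup E] {m : ℕ} (h : E → ℝ) (h1 : ∀ v, 1 ≤ h v)
    (h0 : h 0 = 1) (hsub : ∀ v w, h (v - w) ≤ h v * h w) (ξ : Fin m → E) :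
    ∏ j, h (finDecr ξ j) ≤ ∏ j, h (ξ j) ^ 2 := by
  have hpos : ∀ v, 0 ≤ h v := fun v => zero_le_one.trans (h1 v)
  have hs : ∏ j : Fin m, h ((Fin.snoc ξ 0 : Fin (m + 1) → E) j.succ) ≤ ∏ j, h (ξ j) := by
    have e := (Fin.prod_univ_succ fun j : Fin (m + 1) => h ((Fin.snoc ξ 0 : Fin (m + 1) → E) j)).symm.trans
      (Fin.prod_univ_castSucc _)
    simp only [Fin.snoc_castSucc, Fin.snoc_last, h0, mul_one] at e
    rw [← e]
    exact le_mul_of_one_le_left (Finset.prod_nonneg fun _ _ => hpos _) (h1 _)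
  calc ∏ j, h (finDecr ξ j) ≤ ∏ j, h (ξ j) * h ((Fin.snoc ξ 0 : Fin (m + 1) → E) j.succ) :=
        Finset.prod_le_prod (fun _ _ => hpos _) fun j _ => hsub _ _
    _ = (∏ j, h (ξ j)) * ∏ j : Fin m, h ((Fin.snoc ξ 0 : Fin (m + 1) → E) j.succ) :=
        Finset.prod_mul_distrib
    _ ≤ (∏ j, h (ξ j)) * ∏ j, h (ξ j) :=
        mul_le_mul_of_nonneg_left hs (Finset.prod_nonneg fun _ _ => hpos _)
    _ = _ := by rw [← Finset.prod_mul_distrib]; simp only [sq]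

/-- The weight `∏ₗ (1 + |vₗ|)^δ` on frequencies. -/
def freqWeight {d : ℕ} (δ : ℝ) (v : Fin d → ℝ) : ℝ := ∏ l, (1 + |v l|) ^ δ

theorem one_le_freqWeight {d : ℕ} {δ : ℝ} (hδ : 0 ≤ δ) (v : Fin d → ℝ) : 1 ≤ freqWeight δ v :=
  Finset.one_le_prod fun l _ => Real.one_le_rpow (by linarith [abs_nonneg (v l)]) hδ

theorem freqWeight_sub_le {d : ℕ} {δ : ℝ} (hδ : 0 ≤ δ) (v w : Fin d → ℝ) :
    freqWeight δ (v - w) ≤ freqWeight δ v * freqWeight δ w := by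
  rw [freqWeight, freqWeight, freqWeight, ← Finset.prod_mul_distrib]
  refine Finset.prod_le_prod (fun _ _ => by positivity) fun l _ => ?_
  rw [← Real.mul_rpow (by positivity) (by positivity)]
  refine Real.rpow_le_rpow (by positivity) ?_ hδ
  have := abs_sub (v l) (w l)
  simp only [Pi.sub_apply]
  nlinarith [abs_nonneg (v l), abs_nonneg (w l), mul_nonneg (abs_nonneg (v l)) (abs_nonneg (w l))]

theorem freqWeight_sq {d : ℕ} (δ : ℝ) (v : Fin d → ℝ) :
    freqWeight δ v ^ 2 = ∏ l, (1 + |v l|) ^ (2 * δ) := by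
  rw [freqWeight, ← Finset.prod_pow]
  refine Finset.prod_congr rfl fun l _ => ?_
  rw [mul_comm, Real.rpow_mul (by positivity)]
  norm_cast

/-- Decay of the characteristic functions of the increments of a process started at `0`. -/
def CharDecay {Ω : Type*} [MeasurableSpace Ω] {d : ℕ} (P : Measure Ω)
    (Y : ℝ → Ω → Ed d) (T α : ℝ) : Prop :=
  ∀ m : ℕ, 0 < m → ∃ C : ℝ, 0 ≤ C ∧ ∀ ξ : Fin m → Fin d → ℝ, (∀ j l, ξ j l ≠ 0) →
    ∀ s : Fin m → ℝ, StrictMono s → (∀ j, s j ∈ Ioo 0 T) →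
      ‖∫ ω, Complex.exp (Complex.I * Complex.ofReal
        (∑ j, ∑ l, ξ j l * finIncr 0 (fun i => Y (s i) ω l) j)) ∂P‖ ≤
        C * ∏ j, ∏ l, ((1 + finIncr 0 s j ^ α * |ξ j l|) ^ 4)⁻¹

theorem CondA1.charDecay {Ω : Type*} [MeasurableSpace Ω] {d : ℕ} {P : Measure Ω}
    {X Y : ℝ → Ω → Ed d} {T α θ : ℝ} (hA1 : CondA1 P X T α θ)
    (hXY : ∀ᵐ ω ∂P, ∀ t ∈ Icc 0 T, Y t ω = X t ω - X 0 ω) : CharDecay P Y T α := by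
  obtain ⟨C, hC, h⟩ := hA1
  intro m hm
  refine ⟨C ^ m * (m : ℝ) ^ (α * θ * (m : ℝ)) * ∏ _j : Fin m, ∏ _l : Fin d, 2 ^ 4,
    by positivity, ?_⟩
  intro ξ hξ s hs hsT
  set t : Fin (m + 1) → ℝ := Fin.cons 0 s with ht
  have hΔ : ∀ j : Fin m, t j.succ - t j.castSucc = finIncr 0 s j := fun j => by
    simp [ht, finIncr]
  have hΔpos : ∀ j, 0 < finIncr 0 s j := fun j => (finIncr_mem_Ioo hs hsT j).1
  have hΔα : ∀ j, 0 < finIncr 0 s j ^ α := fun j => Real.rpow_pos_of_pos (hΔpos j) _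
  have htm : StrictMono t := strictMono_cons_zero hs fun j => (hsT j).1
  have hlast : t (Fin.last m) < T := by
    obtain ⟨n, rfl⟩ : ∃ n, m = n + 1 := ⟨m - 1, by omega⟩
    rw [ht, ← Fin.succ_last, Fin.cons_succ]
    exact (hsT _).2
  let k : Fin m → Fin d → ℕ := fun j l => if finIncr 0 s j ^ α * |ξ j l| ≤ 1 then 0 else 4
  have hk : ∀ j l, k j l = 0 ∨ k j l = 4 := fun j l => by
    simp only [k]; split_ifs <;> simp
  have key := h m hm (fun j => WithLp.toLp 2 (ξ j)) hξ t htm (by simp [ht]) hlast k hk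
  have hint : ∫ ω, Complex.exp (Complex.I * Complex.ofReal
        (∑ j, ∑ l, ξ j l * finIncr 0 (fun i => Y (s i) ω l) j)) ∂P
      = ∫ ω, Complex.exp (Complex.I * Complex.ofReal
        (∑ j, ⟪(WithLp.toLp 2 (ξ j) : Ed d), X (t j.succ) ω - X (t j.castSucc) ω⟫)) ∂P := by
    refine integral_congr_ae ?_
    filter_upwards [hXY] with ω hω
    congr 3
    refine Finset.sum_congr rfl fun j _ => ?_
    rw [PiLp.inner_apply]
    refine Finset.sum_congr rfl fun l _ => ?_
    have hYs : ∀ i, Y (s i) ω l = X (s i) ω l - X 0 ω l := fun i => by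
      rw [hω (s i) ⟨(hsT i).1.le, (hsT i).2.le⟩]; rfl
    have e : finIncr 0 (fun i => Y (s i) ω l) j
        = X (t j.succ) ω l - X (t j.castSucc) ω l := by
      simp only [finIncr, hYs, ht, Fin.cons_succ]
      generalize j.castSucc = i
      refine Fin.cases ?_ (fun i => ?_) i <;> simp
    rw [e]
    simp [mul_comm]
  rw [hint]
  refine key.trans ?_
  rw [mul_assoc _ (∏ _j : Fin m, ∏ _l : Fin d, _) _, ← Finset.prod_mul_distrib]
  refine mul_le_mul_of_nonneg_left ?_ (by positivity)
  refine Finset.prod_le_prod (fun j _ => Finset.prod_nonneg fun l _ => ?_) fun j _ => ?_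
  · rw [hΔ]
    have := Real.rpow_nonneg (hΔpos j).le (α * (k j l : ℝ))
    positivity
  rw [← Finset.prod_mul_distrib]
  refine Finset.prod_le_prod (fun l _ => ?_) fun l _ => ?_
  · rw [hΔ]
    have := Real.rpow_nonneg (hΔpos j).le (α * (k j l : ℝ))
    positivity
  rw [hΔ]
  set r := finIncr 0 s j ^ α with hr
  have hrpos : 0 < r := hΔα j
  have hx : 0 < |ξ j l| := abs_pos.2 (hξ j l)
  by_cases hle : r * |ξ j l| ≤ 1
  · have : k j l = 0 := if_pos hle
    rw [this]
    simp only [pow_zero, inv_one, Nat.cast_zero, mul_zero, Real.rpow_zero, mul_one]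
    rw [← div_eq_mul_inv, one_le_div (by positivity)]
    exact pow_le_pow_left₀ (by positivity) (by linarith) 4
  · have : k j l = 4 := if_neg hle
    rw [this, Real.rpow_mul (hΔpos j).le, ← hr]
    push Not at hle
    rw [Real.rpow_natCast, ← mul_inv, ← mul_pow, ← div_eq_mul_inv, ← inv_pow, ← div_pow]
    refine pow_le_pow_left₀ (by positivity) ?_ 4
    rw [inv_eq_one_div, div_le_div_iff₀ (by positivity) (by positivity)]
    nlinarith

end FourierBound

section Moments

theorem measurable_euclideanSpace_apply {d : ℕ} (l : Fin d) : Measurable fun y : Ed d => y l :=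
  (show Continuous fun y : Ed d => y l by fun_prop).measurable

theorem enorm_integral_prod_le {Ω : Type*} [MeasurableSpace Ω] {d m : ℕ} (P : Measure Ω)
    [IsProbabilityMeasure P] (a : (Fin d → ℝ) → ℝ) (ha : Continuous a) (hai : Integrable a)
    (ψ : Ed d → ℝ)
    (hψ : ∀ y, (ψ y : ℂ) = ∫ v : Fin d → ℝ, (a v : ℂ) * Complex.exp (Complex.I * (∑ l, v l * y l : ℝ)))
    (Z : Fin m → Ω → Ed d) (hZ : ∀ j, Measurable (Z j)) (x : Ed d) :
    ‖∫ ω, ∏ j, ψ (Z j ω - x) ∂P‖ₑ ≤ ∫⁻ u : Fin m → Fin d → ℝ, (∏ j, ‖a (u j)‖ₑ) *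
      ‖∫ ω, Complex.exp (Complex.I * (∑ j, ∑ l, u j l * Z j ω l : ℝ)) ∂P‖ₑ := by
  set F : Ω → (Fin m → Fin d → ℝ) → ℂ := fun ω u =>
    ∏ j, ((a (u j) : ℂ) * Complex.exp (Complex.I * (∑ l, u j l * (Z j ω - x) l : ℝ))) with hF
  have hFeq : ∀ ω u, F ω u = ((∏ j, (a (u j) : ℂ)) *
      Complex.exp (-(Complex.I * (∑ j, ∑ l, u j l * x l : ℝ)))) *
        Complex.exp (Complex.I * (∑ j, ∑ l, u j l * Z j ω l : ℝ)) := by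
    intro ω u
    simp only [hF]
    rw [Finset.prod_mul_distrib, ← Complex.exp_sum, mul_assoc, ← Complex.exp_add]
    congr 2
    push_cast
    rw [← Finset.mul_sum, ← mul_neg, ← mul_add, neg_add_eq_sub, ← Finset.sum_sub_distrib]
    congr 1
    refine Finset.sum_congr rfl fun j _ => ?_
    rw [← Finset.sum_sub_distrib]
    refine Finset.sum_congr rfl fun l _ => ?_
    simp [mul_sub]
  have hmeasF : Measurable (Function.uncurry F) := by
    refine Finset.measurable_prod _ fun j _ => ?_
    have h1 : Measurable fun p : Ω × (Fin m → Fin d → ℝ) => a (p.2 j) :=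
      ha.measurable.comp (by fun_prop)
    have h2 : Measurable fun p : Ω × (Fin m → Fin d → ℝ) => ∑ l, p.2 j l * (Z j p.1 - x) l := by
      refine Finset.measurable_sum _ fun l _ => Measurable.mul (by fun_prop) ?_
      have : Measurable fun p : Ω × (Fin m → Fin d → ℝ) => Z j p.1 - x :=
        ((hZ j).comp measurable_fst).sub_const x
      exact (measurable_euclideanSpace_apply l).comp this
    exact (Complex.measurable_ofReal.comp h1).mul
      (Complex.measurable_exp.comp ((Complex.measurable_ofReal.comp h2).const_mul _))
  have hnorm : ∀ ω u, ‖F ω u‖ = ∏ j, ‖a (u j)‖ := by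
    intro ω u
    simp only [hF, norm_prod, norm_mul, Complex.norm_real]
    refine Finset.prod_congr rfl fun j _ => ?_
    rw [mul_comm Complex.I, Complex.norm_exp_ofReal_mul_I, mul_one]
  have hFint : Integrable (Function.uncurry F) (P.prod volume) := by
    have h1 : Integrable (fun u : Fin m → Fin d → ℝ => ∏ j, ‖a (u j)‖) :=
      Integrable.fintype_prod (f := fun _ v => ‖a v‖) (fun _ => hai.norm)
    refine (h1.comp_snd P).mono' hmeasF.aestronglyMeasurable ?_
    exact Eventually.of_forall fun p => (hnorm p.1 p.2).le
  have hstep : ((∫ ω, ∏ j, ψ (Z j ω - x) ∂P : ℝ) : ℂ) = ∫ u, ∫ ω, F ω u ∂P := by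
    rw [← integral_integral_swap hFint, ← integral_complex_ofReal]
    refine integral_congr_ae (Eventually.of_forall fun ω => ?_)
    simp only [hF]
    rw [Complex.ofReal_prod, integral_fintype_prod_volume_eq_prod (fun j (v : Fin d → ℝ) =>
      (a v : ℂ) * Complex.exp (Complex.I * (∑ l, v l * (Z j ω - x) l : ℝ)))]
    exact Finset.prod_congr rfl fun j _ => hψ _
  calc ‖∫ ω, ∏ j, ψ (Z j ω - x) ∂P‖ₑ
      = ‖((∫ ω, ∏ j, ψ (Z j ω - x) ∂P : ℝ) : ℂ)‖ₑ := by
        rw [← ofReal_norm, ← ofReal_norm, Complex.norm_real]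
    _ ≤ ∫⁻ u, ‖∫ ω, F ω u ∂P‖ₑ := by rw [hstep]; exact enorm_integral_le_lintegral_enorm _
    _ = _ := by
        refine lintegral_congr fun u => ?_
        simp only [hFeq]
        rw [integral_const_mul, enorm_mul, enorm_mul]
        congr 1
        have e1 : ‖Complex.exp (-(Complex.I * (∑ j, ∑ l, u j l * x l : ℝ)))‖ₑ = 1 := by
          rw [← mul_neg, ← Complex.ofReal_neg, mul_comm, ← ofReal_norm,
            Complex.norm_exp_ofReal_mul_I, ENNReal.ofReal_one]
        rw [e1, mul_one]
        simp only [← ofReal_norm, norm_prod, Complex.norm_real]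
        exact ENNReal.ofReal_prod_of_nonneg fun _ _ => norm_nonneg _

/-- The singular weight produced by an increment of length `r` in the moment estimates. -/
def timeWeight (d : ℕ) (K α q r : ℝ) : ℝ≥0∞ :=
  ENNReal.ofReal ((K * r ^ (-(α * (1 + q)))) ^ d)

theorem ae_forall_ne_zero {m d : ℕ} :
    ∀ᵐ ξ : Fin m → Fin d → ℝ, ∀ j l, ξ j l ≠ 0 := by
  refine ae_all_iff.2 fun j => ae_all_iff.2 fun l => ?_
  have h1 : Measure.QuasiMeasurePreserving (fun ξ : Fin m → Fin d → ℝ => ξ j) volume volume :=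
    Measure.quasiMeasurePreserving_eval _ j
  have h2 : Measure.QuasiMeasurePreserving (fun v : Fin d → ℝ => v l) volume volume :=
    Measure.quasiMeasurePreserving_eval _ l
  exact (h2.comp h1).ae (p := fun x : ℝ => x ≠ 0) (Measure.ae_ne volume 0)

theorem exists_enorm_integral_prod_le_timeWeight {Ω : Type*} [MeasurableSpace Ω] {d m : ℕ}
    (P : Measure Ω) [IsProbabilityMeasure P] (Y : ℝ → Ω → Ed d) (hY : ∀ t, Measurable (Y t))
    {T α δ : ℝ} (hα : 0 < α) (hδ : 0 ≤ δ) (hδ1 : 2 * δ ≤ 1) (hm : 0 < m)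
    (hchar : CharDecay P Y T α) :
    ∃ K : ℝ, 0 ≤ K ∧ ∃ C : ℝ, 0 ≤ C ∧ ∀ (A : ℝ) (a : (Fin d → ℝ) → ℝ), 0 ≤ A → Continuous a → Integrable a →
      (∀ v, ‖a v‖ ≤ A * freqWeight δ v) → ∀ ψ : Ed d → ℝ,
      (∀ y, (ψ y : ℂ) =
        ∫ v : Fin d → ℝ, (a v : ℂ) * Complex.exp (Complex.I * (∑ l, v l * y l : ℝ))) →
      ∀ (x : Ed d) (s : Fin m → ℝ), StrictMono s → (∀ j, s j ∈ Ioo 0 T) →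
        ‖∫ ω, ∏ j, ψ (Y (s j) ω - x) ∂P‖ₑ ≤
          ENNReal.ofReal (A ^ m * C) * ∏ j, timeWeight d K α (2 * δ) (finIncr 0 s j) := by
  obtain ⟨C, hC, hbound⟩ := hchar m hm
  set M : ℝ := max 1 (T ^ α) with hM
  set J : ℝ := ∫ x : ℝ, (1 + ‖x‖) ^ (-3 : ℝ) with hJ
  have hJ0 : 0 ≤ J := integral_nonneg fun x => by positivity
  refine ⟨M ^ (2 * δ) * J, by positivity, C, hC, ?_⟩
  intro A a hA ha hai haw ψ hψ x s hs hsT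
  refine (enorm_integral_prod_le P a ha hai ψ hψ (fun j => Y (s j)) (fun j => hY _) x).trans ?_
  have hΔ : ∀ j, finIncr 0 s j ∈ Ioo 0 T := finIncr_mem_Ioo hs hsT
  set g : Fin m → (Fin d → ℝ) → ℝ≥0∞ := fun j v => ENNReal.ofReal
    (∏ l, ((1 + |v l|) ^ (2 * δ) * ((1 + finIncr 0 s j ^ α * |v l|) ^ 4)⁻¹)) with hg
  have hgm : ∀ j, Measurable (g j) := fun j => by
    refine ENNReal.measurable_ofReal.comp (Finset.measurable_prod _ fun l _ => ?_)
    fun_prop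
  set H : (Fin m → Fin d → ℝ) → ℝ≥0∞ := fun u => (∏ j, ‖a (u j)‖ₑ) *
      ‖∫ ω, Complex.exp (Complex.I * (∑ j, ∑ l, u j l * Y (s j) ω l : ℝ)) ∂P‖ₑ with hH
  have hHm : Measurable H := by
    refine Measurable.mul (Finset.measurable_prod _ fun j _ => ?_) ?_
    · exact (ha.measurable.comp (measurable_pi_apply j)).enorm
    · have hm2 : Measurable fun p : (Fin m → Fin d → ℝ) × Ω =>
          Complex.exp (Complex.I * (∑ j, ∑ l, p.1 j l * Y (s j) p.2 l : ℝ)) := by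
        have h2 : Measurable fun p : (Fin m → Fin d → ℝ) × Ω =>
            ∑ j, ∑ l, p.1 j l * Y (s j) p.2 l := by
          refine Finset.measurable_sum _ fun j _ => Finset.measurable_sum _ fun l _ =>
            Measurable.mul (by fun_prop) ?_
          exact (measurable_euclideanSpace_apply l).comp
            ((hY (s j)).comp measurable_snd)
        exact Complex.measurable_exp.comp ((Complex.measurable_ofReal.comp h2).const_mul _)
      exact (hm2.stronglyMeasurable.integral_prod_right (ν := P)).measurable.enorm
  have hpt : ∀ ξ : Fin m → Fin d → ℝ, (∀ j l, ξ j l ≠ 0) →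
      H (finDecr ξ) ≤ ENNReal.ofReal (A ^ m * C) * ∏ j, g j (ξ j) := by
    intro ξ hξ
    have h1 : ∏ j, ‖a (finDecr ξ j)‖ ≤ A ^ m * ∏ j, freqWeight δ (ξ j) ^ 2 := by
      calc ∏ j, ‖a (finDecr ξ j)‖ ≤ ∏ j, (A * freqWeight δ (finDecr ξ j)) :=
            Finset.prod_le_prod (fun _ _ => norm_nonneg _) fun j _ => haw _
        _ = A ^ m * ∏ j, freqWeight δ (finDecr ξ j) := by simp [Finset.prod_mul_distrib]
        _ ≤ _ := mul_le_mul_of_nonneg_left (prod_finDecr_le _ (one_le_freqWeight hδ)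
            (by simp [freqWeight]) (freqWeight_sub_le hδ) ξ) (by positivity)
    have hsum : ∀ ω, ∑ j, ∑ l, finDecr ξ j l * Y (s j) ω l
        = ∑ j, ∑ l, ξ j l * finIncr 0 (fun i => Y (s i) ω l) j := by
      intro ω
      rw [Finset.sum_comm]
      conv_rhs => rw [Finset.sum_comm]
      refine Finset.sum_congr rfl fun l _ => ?_
      simp only [finDecr_apply]
      exact sum_finDecr_mul (fun i => ξ i l) (fun i => Y (s i) ω l)
    have h2 := hbound ξ hξ s hs hsT
    simp only [hH, hsum]
    simp only [hg]
    simp only [← ofReal_norm]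
    rw [← ENNReal.ofReal_prod_of_nonneg fun _ _ => norm_nonneg _,
      ← ENNReal.ofReal_prod_of_nonneg (fun j _ => Finset.prod_nonneg fun l _ => ?_),
      ← ENNReal.ofReal_mul (by positivity), ← ENNReal.ofReal_mul (by positivity)]
    swap
    · have := Real.rpow_nonneg (hΔ j).1.le α
      positivity
    refine ENNReal.ofReal_le_ofReal ((mul_le_mul h1 h2 (norm_nonneg _) (by positivity)).trans ?_)
    simp only [freqWeight_sq, Finset.prod_mul_distrib]
    exact le_of_eq (by ring)
  calc ∫⁻ u, H u = ∫⁻ ξ, H (finDecr ξ) := (lintegral_finDecr H hHm).symm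
    _ ≤ ∫⁻ ξ : Fin m → Fin d → ℝ, ENNReal.ofReal (A ^ m * C) * ∏ j, g j (ξ j) := by
        refine lintegral_mono_ae ?_
        filter_upwards [ae_forall_ne_zero] with ξ hξ using hpt ξ hξ
    _ = ENNReal.ofReal (A ^ m * C) * ∏ j, ∫⁻ v, g j v := by
        have h1 : Measurable fun ξ : Fin m → Fin d → ℝ => ∏ j, g j (ξ j) :=
          Finset.measurable_prod _ fun j _ => (hgm j).comp (measurable_pi_apply j)
        rw [lintegral_const_mul _ h1, lintegral_fin_prod_eq_prod g hgm]
    _ ≤ _ := by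
        refine mul_le_mul_right (Finset.prod_le_prod' fun j _ => ?_) _
        have hr : 0 < finIncr 0 s j ^ α := Real.rpow_pos_of_pos (hΔ j).1 _
        have hrM : finIncr 0 s j ^ α ≤ M :=
          (Real.rpow_le_rpow (hΔ j).1.le (hΔ j).2.le hα.le).trans (le_max_right _ _)
        have hgj : ∀ v, g j v = ∏ l, ENNReal.ofReal
            ((1 + |v l|) ^ (2 * δ) * ((1 + finIncr 0 s j ^ α * |v l|) ^ 4)⁻¹) := fun v => by
          simp only [hg]
          exact ENNReal.ofReal_prod_of_nonneg fun l _ => by positivity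
        simp only [hgj]
        rw [lintegral_fin_prod_eq_prod (fun _ y => ENNReal.ofReal
            ((1 + |y|) ^ (2 * δ) * ((1 + finIncr 0 s j ^ α * |y|) ^ 4)⁻¹))
            (fun _ => ENNReal.measurable_ofReal.comp (by fun_prop)), Finset.prod_const,
          Finset.card_univ, Fintype.card_fin, timeWeight, ENNReal.ofReal_pow (by
            have := Real.rpow_nonneg (hΔ j).1.le (-(α * (1 + 2 * δ)))
            positivity)]
        refine pow_le_pow_left' ((lintegral_weight_le (by positivity) hδ1 hr
          (le_max_left _ _) hrM).trans (ENNReal.ofReal_le_ofReal (le_of_eq ?_))) d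
        have hM0 : 0 ≤ M := zero_le_one.trans (le_max_left _ _)
        rw [← hJ, Real.div_rpow hM0 hr.le, ← Real.rpow_mul (hΔ j).1.le, mul_add, mul_one, neg_add,
          Real.rpow_add (hΔ j).1, Real.rpow_neg (hΔ j).1.le, Real.rpow_neg (hΔ j).1.le]
        field_simp

end Moments

section Tails

theorem setLIntegral_timeWeight_lt_top {d : ℕ} {T K α q : ℝ} (hT : 0 < T) (hK : 0 ≤ K)
    (h : d * (α * (1 + q)) < 1) : ∫⁻ r in Ioo 0 T, timeWeight d K α q r < ⊤ := by
  have h1 : IntegrableOn (fun r : ℝ => K ^ d * r ^ (-(d * (α * (1 + q))))) (Ioo 0 T) := by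
    have h2 : IntervalIntegrable (fun r : ℝ => r ^ (-(d * (α * (1 + q))))) volume 0 T :=
      intervalIntegral.intervalIntegrable_rpow' (by linarith)
    rw [intervalIntegrable_iff_integrableOn_Ioo_of_le hT.le] at h2
    exact Integrable.const_mul h2 _
  refine lt_of_le_of_lt ?_ h1.2
  refine setLIntegral_mono' measurableSet_Ioo fun r hr => ?_
  have hr0 := Real.rpow_nonneg hr.1.le (-(d * (α * (1 + q))))
  rw [timeWeight, ← ofReal_norm, Real.norm_of_nonneg (by positivity)]
  refine ENNReal.ofReal_le_ofReal (le_of_eq ?_)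
  rw [mul_pow, ← Real.rpow_natCast (r ^ _), ← Real.rpow_mul hr.1.le]
  congr 2
  ring

/-- Tail bound for the additive functional `∫₀ᵗ ψ(Y_s - x) ds` in terms of the Fourier
transform of `ψ`. -/
theorem exists_tail_bound {Ω : Type*} [MeasurableSpace Ω] {d m : ℕ}
    (P : Measure Ω) [IsProbabilityMeasure P] (Y : ℝ → Ω → Ed d) (hY : ∀ t, Measurable (Y t))
    (hYc : ∀ ω, Continuous fun t => Y t ω)
    {T α δ : ℝ} (hT : 0 < T) (hα : 0 < α) (hδ : 0 ≤ δ) (hδ1 : 2 * δ ≤ 1)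
    (hαδ : d * (α * (1 + 2 * δ)) < 1) (hm : 0 < m) (hme : Even m)
    (hchar : CharDecay P Y T α) :
    ∃ C : ℝ, 0 ≤ C ∧ ∀ (A : ℝ) (a : (Fin d → ℝ) → ℝ), 0 ≤ A → Continuous a → Integrable a →
      (∀ v, ‖a v‖ ≤ A * freqWeight δ v) → ∀ ψ : Ed d → ℝ, Continuous ψ → (∃ B, ∀ y, ‖ψ y‖ ≤ B) →
      (∀ y, (ψ y : ℂ) =
        ∫ v : Fin d → ℝ, (a v : ℂ) * Complex.exp (Complex.I * (∑ l, v l * y l : ℝ))) →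
      ∀ (x : Ed d), ∀ t ∈ Icc 0 T, ∀ ε : ℝ, 0 < ε →
        P {ω | ε ≤ |∫ s in (0 : ℝ)..t, ψ (Y s ω - x)|} ≤ ENNReal.ofReal (C * (A / ε) ^ m) := by
  obtain ⟨K, hK, C, hC, hbound⟩ :=
    exists_enorm_integral_prod_le_timeWeight P Y hY hα hδ hδ1 hm hchar
  set I := ∫⁻ r in Ioo 0 T, timeWeight d K α (2 * δ) r with hI
  have hItop : I ≠ ⊤ := (setLIntegral_timeWeight_lt_top hT hK hαδ).ne
  set N := Fintype.card (Equiv.Perm (Fin m)) with hN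
  refine ⟨N * (C * I.toReal ^ m), by positivity, ?_⟩
  intro A a hA ha hai haw ψ hψc ⟨B, hB⟩ hψ x t ht ε hε
  have hYm : Measurable fun p : ℝ × Ω => Y p.1 p.2 :=
    measurable_uncurry_of_continuous_of_measurable hYc hY
  have hψm : Measurable fun p : ℝ × Ω => ψ (Y p.1 p.2 - x) :=
    hψc.measurable.comp (hYm.sub_const x)
  have hB0 : 0 ≤ B := (norm_nonneg _).trans (hB 0)
  set G : Ω → ℝ := fun ω => ∫ s in (0 : ℝ)..t, ψ (Y s ω - x) with hG
  have hGm : Measurable G := by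
    simp only [hG, intervalIntegral.integral_of_le ht.1]
    have : StronglyMeasurable (Function.uncurry fun (ω : Ω) (s : ℝ) => ψ (Y s ω - x)) :=
      (hψm.comp measurable_swap).stronglyMeasurable
    exact this.integral_prod_right.measurable
  have hGb : ∀ ω, ‖G ω‖ ≤ B * |t - 0| := fun ω =>
    intervalIntegral.norm_integral_le_of_norm_le_const fun s _ => hB _
  have hGint : Integrable (fun ω => G ω ^ m) P := by
    refine Integrable.of_bound (hGm.pow_const m).aestronglyMeasurable ((B * |t - 0|) ^ m)
      (Eventually.of_forall fun ω => ?_)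
    rw [norm_pow]
    exact pow_le_pow_left₀ (norm_nonneg _) (hGb ω) m
  set μ : Measure (Fin m → ℝ) := Measure.pi fun _ : Fin m => volume.restrict (Ioo 0 t) with hμ
  have hμr : μ = (volume : Measure (Fin m → ℝ)).restrict (Set.univ.pi fun _ => Ioo 0 t) := by
    rw [hμ, volume_pi, Measure.restrict_pi_pi]
  have hGpow : ∀ ω, G ω ^ m = ∫ s, ∏ j, ψ (Y (s j) ω - x) ∂μ := by
    intro ω
    rw [hμ, integral_fintype_prod_eq_pow (fun s => ψ (Y s ω - x)), Fintype.card_fin]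
    simp only [hG]
    rw [intervalIntegral.integral_of_le ht.1, integral_Ioc_eq_integral_Ioo]
  have hswap : ∫ ω, G ω ^ m ∂P = ∫ s, ∫ ω, ∏ j, ψ (Y (s j) ω - x) ∂P ∂μ := by
    simp only [hGpow]
    refine integral_integral_swap ?_
    refine Integrable.of_bound (C := B ^ m) ?_ (Eventually.of_forall fun p => ?_)
    · refine (Finset.measurable_prod _ fun j _ => ?_).aestronglyMeasurable
      exact hψm.comp (Measurable.prodMk (by fun_prop) measurable_fst)
    · simp only [Function.uncurry]
      rw [norm_prod]
      calc ∏ j, ‖ψ (Y (p.2 j) p.1 - x)‖ ≤ ∏ _j : Fin m, B :=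
            Finset.prod_le_prod (fun _ _ => norm_nonneg _) fun _ _ => hB _
        _ = B ^ m := by simp
  have hmoment : ENNReal.ofReal (∫ ω, G ω ^ m ∂P) ≤
      ENNReal.ofReal (N * (C * I.toReal ^ m) * A ^ m) := by
    calc ENNReal.ofReal (∫ ω, G ω ^ m ∂P) ≤ ‖∫ ω, G ω ^ m ∂P‖ₑ := by
          rw [← ofReal_norm]
          exact ENNReal.ofReal_le_ofReal (Real.le_norm_self _)
      _ ≤ ∫⁻ s, ‖∫ ω, ∏ j, ψ (Y (s j) ω - x) ∂P‖ₑ ∂μ := by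
          rw [hswap]; exact enorm_integral_le_lintegral_enorm _
      _ ≤ ∫⁻ s in Set.univ.pi fun _ : Fin m => Ioo 0 T,
            ‖∫ ω, ∏ j, ψ (Y (s j) ω - x) ∂P‖ₑ := by
          rw [hμr]
          exact lintegral_mono_set (Set.pi_mono fun _ _ => Ioo_subset_Ioo_right ht.2)
      _ ≤ N * (ENNReal.ofReal (A ^ m * C) * I ^ m) := by
          refine setLIntegral_cube_le_of_symmetric _ (fun σ s => ?_) _ _ ?_ ?_
          · congr 2
            ext ω
            exact Equiv.prod_comp σ fun j => ψ (Y (s j) ω - x)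
          · unfold timeWeight
            exact ENNReal.measurable_ofReal.comp (by fun_prop)
          · exact hbound A a hA ha hai haw ψ hψ x
      _ = _ := by
          rw [← ENNReal.ofReal_toReal hItop, ← ENNReal.ofReal_pow ENNReal.toReal_nonneg,
            ← ENNReal.ofReal_mul (by positivity), ← ENNReal.ofReal_natCast N,
            ← ENNReal.ofReal_mul (by positivity)]
          simp only [ENNReal.toReal_ofReal ENNReal.toReal_nonneg]
          congr 1
          ring
  have hmarkov := mul_meas_ge_le_integral_of_nonneg
    (Eventually.of_forall fun ω => hme.pow_nonneg (G ω)) hGint (ε ^ m)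
  have hsub : {ω | ε ≤ |G ω|} ⊆ {ω | ε ^ m ≤ G ω ^ m} := fun ω hω => by
    simp only [mem_ofPred_eq] at hω ⊢
    rw [← hme.pow_abs (G ω)]
    exact pow_le_pow_left₀ hε.le hω m
  have hle : ∫ ω, G ω ^ m ∂P ≤ N * (C * I.toReal ^ m) * A ^ m :=
    (ENNReal.ofReal_le_ofReal_iff (by positivity)).1 hmoment
  calc P {ω | ε ≤ |G ω|} ≤ P {ω | ε ^ m ≤ G ω ^ m} := measure_mono hsub
    _ = ENNReal.ofReal (P.real {ω | ε ^ m ≤ G ω ^ m}) := (ofReal_measureReal).symm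
    _ ≤ _ := by
      refine ENNReal.ofReal_le_ofReal ?_
      rw [div_pow, mul_div_assoc', le_div_iff₀ (by positivity)]
      linarith

end Tails

section Kernel

variable {d : ℕ}

/-- The standard heat kernel at time one, as a probability density. -/
def gaussKernel (y : Ed d) : ℝ :=
  ((2 * Real.pi) ^ d)⁻¹ * Real.pi ^ ((d : ℝ) / 2) * Real.exp (-(1 / 4) * ‖y‖ ^ 2)

/-- The rescaled heat kernel, concentrated on length scale `N⁻¹`. -/
def scaledKernel (N : ℝ) (y : Ed d) : ℝ := N ^ d * gaussKernel (N • y)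

/-- The Fourier amplitude of `scaledKernel`. -/
def gaussAmp (N : ℝ) (v : Fin d → ℝ) : ℝ :=
  ((2 * Real.pi) ^ d)⁻¹ * Real.exp (-(N⁻¹ ^ 2) * ∑ l, v l ^ 2)

theorem gaussKernel_nonneg (y : Ed d) : 0 ≤ gaussKernel y := by
  unfold gaussKernel
  positivity

theorem continuous_gaussKernel : Continuous (gaussKernel : Ed d → ℝ) := by
  unfold gaussKernel
  fun_prop

theorem integral_gaussKernel : ∫ y : Ed d, gaussKernel y = 1 := by
  unfold gaussKernel
  rw [integral_const_mul, GaussianFourier.integral_rexp_neg_mul_sq_norm (by norm_num)]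
  rw [finrank_euclideanSpace_fin, mul_assoc, ← Real.mul_rpow (by positivity) (by positivity)]
  have : Real.pi * (Real.pi / (1 / 4)) = (2 * Real.pi) ^ (2 : ℝ) := by
    rw [Real.rpow_two]; ring
  rw [this, ← Real.rpow_mul (by positivity)]
  rw [mul_div_cancel₀ _ (by norm_num), Real.rpow_natCast]
  exact inv_mul_cancel₀ (by positivity)

theorem integrable_gaussKernel : Integrable (gaussKernel : Ed d → ℝ) := by
  by_contra h
  have := integral_gaussKernel (d := d)
  rw [integral_undef h] at this
  exact zero_ne_one this

theorem kernelConst_le_one : ((2 * Real.pi) ^ d)⁻¹ * Real.pi ^ ((d : ℝ) / 2) ≤ 1 := by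
  rw [inv_mul_le_iff₀ (by positivity), mul_one, ← Real.rpow_natCast]
  have hpi := Real.pi_gt_three
  calc Real.pi ^ ((d : ℝ) / 2) ≤ Real.pi ^ (d : ℝ) :=
        Real.rpow_le_rpow_of_exponent_le (by linarith) (by linarith [(d.cast_nonneg : (0:ℝ) ≤ d)])
    _ ≤ (2 * Real.pi) ^ (d : ℝ) :=
        Real.rpow_le_rpow (by positivity) (by linarith) (by positivity)

theorem gaussKernel_le_one (y : Ed d) : gaussKernel y ≤ 1 := by
  unfold gaussKernel
  refine mul_le_one₀ kernelConst_le_one (by positivity) (Real.exp_le_one_iff.2 ?_)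
  nlinarith [sq_nonneg ‖y‖]

theorem abs_exp_neg_sq_sub_le (a b : ℝ) :
    |Real.exp (-(1 / 4) * a ^ 2) - Real.exp (-(1 / 4) * b ^ 2)| ≤ |a - b| := by
  have hderiv : ∀ x : ℝ, HasDerivAt (fun x : ℝ => Real.exp (-(1 / 4) * x ^ 2))
      (Real.exp (-(1 / 4) * x ^ 2) * (-(1 / 4) * (2 * x))) x := fun x => by
    have := ((hasDerivAt_pow 2 x).const_mul (-(1 / 4) : ℝ)).exp
    simpa using this
  have hbound : ∀ x : ℝ, ‖Real.exp (-(1 / 4) * x ^ 2) * (-(1 / 4) * (2 * x))‖ ≤ 1 := fun x => by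
    rw [norm_mul, Real.norm_eq_abs, Real.abs_exp, Real.norm_eq_abs]
    have h1 : |-(1 / 4) * (2 * x)| ≤ Real.exp (1 / 4 * x ^ 2) := by
      refine le_trans ?_ (Real.add_one_le_exp _)
      rw [abs_le]
      constructor <;> nlinarith [sq_nonneg (x - 1), sq_nonneg (x + 1)]
    calc _ ≤ Real.exp (-(1 / 4) * x ^ 2) * Real.exp (1 / 4 * x ^ 2) := by gcongr
      _ = 1 := by rw [← Real.exp_add]; ring_nf; exact Real.exp_zero
  have := convex_univ.norm_image_sub_le_of_norm_hasDerivWithin_le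
    (fun x _ => (hderiv x).hasDerivWithinAt) (fun x _ => hbound x) (mem_univ b) (mem_univ a)
  simpa using this

theorem abs_gaussKernel_sub_le (y z : Ed d) : |gaussKernel y - gaussKernel z| ≤ ‖y - z‖ := by
  unfold gaussKernel
  rw [← mul_sub, abs_mul, abs_of_nonneg (by positivity : (0 : ℝ) ≤ ((2 * Real.pi) ^ d)⁻¹ *
    Real.pi ^ ((d : ℝ) / 2))]
  calc _ ≤ 1 * |‖y‖ - ‖z‖| :=
        mul_le_mul kernelConst_le_one (abs_exp_neg_sq_sub_le _ _) (abs_nonneg _) zero_le_one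
    _ ≤ ‖y - z‖ := by rw [one_mul]; exact abs_norm_sub_norm_le y z

theorem scaledKernel_nonneg {N : ℝ} (hN : 0 ≤ N) (y : Ed d) : 0 ≤ scaledKernel N y :=
  mul_nonneg (by positivity) (gaussKernel_nonneg _)

theorem continuous_scaledKernel (N : ℝ) : Continuous (scaledKernel N : Ed d → ℝ) :=
  continuous_const.mul (continuous_gaussKernel.comp (continuous_const_smul N))

theorem scaledKernel_le {N : ℝ} (hN : 0 ≤ N) (y : Ed d) : scaledKernel N y ≤ N ^ d :=
  mul_le_of_le_one_right (by positivity) (gaussKernel_le_one _)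

theorem abs_scaledKernel_sub_le {N : ℝ} (hN : 0 ≤ N) (y z : Ed d) :
    |scaledKernel N y - scaledKernel N z| ≤ N ^ (d + 1) * ‖y - z‖ := by
  unfold scaledKernel
  rw [← mul_sub, abs_mul, abs_of_nonneg (by positivity : 0 ≤ N ^ d), pow_succ, mul_assoc]
  gcongr
  calc _ ≤ ‖N • y - N • z‖ := abs_gaussKernel_sub_le _ _
    _ = N * ‖y - z‖ := by rw [← smul_sub, norm_smul, Real.norm_of_nonneg hN]

theorem continuous_gaussAmp (N : ℝ) : Continuous (gaussAmp N : (Fin d → ℝ) → ℝ) := by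
  unfold gaussAmp
  fun_prop

theorem integrable_gaussAmp_mul_cexp {N : ℝ} (hN : 0 < N) (y : Ed d) :
    Integrable fun v : Fin d → ℝ =>
      (gaussAmp N v : ℂ) * Complex.exp (Complex.I * (∑ l, v l * y l : ℝ)) := by
  have hb : 0 < (((N⁻¹ ^ 2 : ℝ)) : ℂ).re := by rw [Complex.ofReal_re]; positivity
  refine ((GaussianFourier.integrable_cexp_neg_mul_sum_add hb
    fun l => Complex.I * y l).const_mul ((((2 * Real.pi) ^ d)⁻¹ : ℝ) : ℂ)).congr
    (Eventually.of_forall fun v => ?_)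
  simp only [gaussAmp]
  rw [Complex.exp_add, Complex.ofReal_mul, mul_assoc]
  congr 2
  · push_cast; rfl
  · push_cast
    rw [Finset.mul_sum]
    congr 1
    exact Finset.sum_congr rfl fun l _ => by ring

theorem integrable_gaussAmp {N : ℝ} (hN : 0 < N) :
    Integrable (gaussAmp N : (Fin d → ℝ) → ℝ) := by
  have := (integrable_gaussAmp_mul_cexp (d := d) hN 0).re
  simpa using this

theorem scaledKernel_eq_integral {N : ℝ} (hN : 0 < N) (y : Ed d) :
    (scaledKernel N y : ℂ) = ∫ v : Fin d → ℝ,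
      (gaussAmp N v : ℂ) * Complex.exp (Complex.I * (∑ l, v l * y l : ℝ)) := by
  have hb : 0 < (((N⁻¹ ^ 2 : ℝ)) : ℂ).re := by rw [Complex.ofReal_re]; positivity
  have key := GaussianFourier.integral_cexp_neg_mul_sum_add hb fun l => Complex.I * y l
  have heq : ∀ v : Fin d → ℝ,
      (gaussAmp N v : ℂ) * Complex.exp (Complex.I * (∑ l, v l * y l : ℝ)) =
      ((((2 * Real.pi) ^ d)⁻¹ : ℝ) : ℂ) * Complex.exp (-((N⁻¹ ^ 2 : ℝ) : ℂ) *
        ∑ l, (v l : ℂ) ^ 2 + ∑ l, Complex.I * y l * v l) := fun v => by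
    simp only [gaussAmp]
    rw [Complex.exp_add, Complex.ofReal_mul, mul_assoc]
    congr 2
    · push_cast; rfl
    · push_cast
      rw [Finset.mul_sum]
      congr 1
      exact Finset.sum_congr rfl fun l _ => by ring
  simp only [heq]
  rw [integral_const_mul, key]
  have h1 : ((Real.pi : ℂ) / ((N⁻¹ ^ 2 : ℝ) : ℂ)) ^ ((Fintype.card (Fin d) : ℂ) / 2) =
      ((N ^ d * Real.pi ^ ((d : ℝ) / 2) : ℝ) : ℂ) := by
    have : N ^ d * Real.pi ^ ((d : ℝ) / 2) = (Real.pi / N⁻¹ ^ 2) ^ ((d : ℝ) / 2) := by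
      rw [inv_pow, div_inv_eq_mul, mul_comm Real.pi, Real.mul_rpow (by positivity) (by positivity),
        ← Real.rpow_natCast N 2, ← Real.rpow_mul hN.le]
      congr 1
      rw [← Real.rpow_natCast]
      congr 1
      push_cast
      ring
    rw [this, Complex.ofReal_cpow (by positivity), Fintype.card_fin]
    push_cast
    rfl
  have h2 : (∑ l, (Complex.I * (y l : ℂ)) ^ 2) / (4 * ((N⁻¹ ^ 2 : ℝ) : ℂ)) =
      ((-(1 / 4) * ‖N • y‖ ^ 2 : ℝ) : ℂ) := by
    rw [norm_smul, mul_pow, EuclideanSpace.norm_sq_eq, Real.norm_eq_abs, sq_abs]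
    simp only [mul_pow, Complex.I_sq, Real.norm_eq_abs, sq_abs, ← Finset.mul_sum]
    have hN' : (N : ℂ) ≠ 0 := by exact_mod_cast hN.ne'
    push_cast
    field_simp
  rw [h1, h2, ← Complex.ofReal_exp, ← Complex.ofReal_mul, ← Complex.ofReal_mul]
  congr 1
  unfold scaledKernel gaussKernel
  ring

theorem one_add_sum_le_prod_one_add {ι : Type*} (s : Finset ι) {f : ι → ℝ} (hf : ∀ i, 0 ≤ f i) :
    1 + ∑ i ∈ s, f i ≤ ∏ i ∈ s, (1 + f i) := by
  classical
  induction s using Finset.induction_on with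
  | empty => simp
  | insert i s hi ih =>
    rw [Finset.sum_insert hi, Finset.prod_insert hi]
    nlinarith [hf i, mul_nonneg (hf i) (Finset.sum_nonneg fun j (_ : j ∈ s) => hf j)]

theorem sum_sq_le_prod (v : Fin d → ℝ) : ∑ l, v l ^ 2 ≤ (∏ l, (1 + |v l|)) ^ 2 := by
  have h1 : ∑ l, v l ^ 2 ≤ (∑ l, |v l|) ^ 2 := by
    have := Finset.sum_sq_le_sq_sum_of_nonneg (s := Finset.univ) (f := fun l => |v l|)
      (fun _ _ => abs_nonneg _)
    simpa using this
  have h2 : ∑ l, |v l| ≤ ∏ l, (1 + |v l|) := by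
    linarith [one_add_sum_le_prod_one_add Finset.univ fun l => abs_nonneg (v l)]
  exact h1.trans (pow_le_pow_left₀ (Finset.sum_nonneg fun _ _ => abs_nonneg _) h2 2)

theorem one_sub_exp_neg_le_rpow {x γ : ℝ} (hx : 0 ≤ x) (hγ : 0 ≤ γ) (hγ1 : γ ≤ 1) :
    1 - Real.exp (-x) ≤ x ^ γ := by
  rcases le_total 1 x with h | h
  · linarith [Real.one_le_rpow h hγ, Real.exp_pos (-x)]
  · rcases hx.eq_or_lt with rfl | hx0
    · simp only [neg_zero, Real.exp_zero, sub_self]; positivity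
    · have := Real.rpow_le_rpow_of_exponent_ge hx0 h hγ1
      rw [Real.rpow_one] at this
      linarith [Real.add_one_le_exp (-x)]

theorem abs_gaussAmp_sub_le {N M δ : ℝ} (hN : 0 < N) (hNM : N ≤ M) (hδ : 0 ≤ δ) (hδ2 : δ ≤ 2)
    (v : Fin d → ℝ) : ‖gaussAmp M v - gaussAmp N v‖ ≤ N⁻¹ ^ δ * freqWeight δ v := by
  set s := ∑ l, v l ^ 2 with hs
  have hs0 : 0 ≤ s := Finset.sum_nonneg fun _ _ => sq_nonneg _
  have hM : 0 < M := hN.trans_le hNM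
  have hmono : Real.exp (-(N⁻¹ ^ 2) * s) ≤ Real.exp (-(M⁻¹ ^ 2) * s) := by
    refine Real.exp_le_exp.2 ?_
    have : M⁻¹ ^ 2 ≤ N⁻¹ ^ 2 := by gcongr
    nlinarith
  have hone : Real.exp (-(M⁻¹ ^ 2) * s) ≤ 1 := by
    rw [Real.exp_le_one_iff, neg_mul]
    have : 0 ≤ M⁻¹ ^ 2 * s := by positivity
    linarith
  have hc : ((2 * Real.pi) ^ d)⁻¹ ≤ 1 :=
    inv_le_one_of_one_le₀ (one_le_pow₀ (by linarith [Real.pi_gt_three]))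
  have hexp := one_sub_exp_neg_le_rpow (x := N⁻¹ ^ 2 * s) (γ := δ / 2) (by positivity)
    (by positivity) (by linarith)
  have hpow : (N⁻¹ ^ 2 * s) ^ (δ / 2) ≤ N⁻¹ ^ δ * freqWeight δ v := by
    calc (N⁻¹ ^ 2 * s) ^ (δ / 2) ≤ ((N⁻¹ * ∏ l, (1 + |v l|)) ^ 2) ^ (δ / 2) := by
          refine Real.rpow_le_rpow (by positivity) ?_ (by positivity)
          rw [mul_pow]
          gcongr
          exact sum_sq_le_prod v
      _ = N⁻¹ ^ δ * freqWeight δ v := by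
          rw [← Real.rpow_natCast, ← Real.rpow_mul (by positivity)]
          have h2 : ((2 : ℕ) : ℝ) * (δ / 2) = δ := by push_cast; ring
          rw [h2, Real.mul_rpow (by positivity) (by positivity),
            ← Real.finsetProd_rpow _ _ (fun _ _ => by positivity)]
          rfl
  unfold gaussAmp
  rw [← mul_sub, Real.norm_of_nonneg (mul_nonneg (by positivity) (sub_nonneg.2 hmono))]
  calc _ ≤ 1 * (Real.exp (-(M⁻¹ ^ 2) * s) - Real.exp (-(N⁻¹ ^ 2) * s)) :=
        mul_le_mul_of_nonneg_right hc (sub_nonneg.2 hmono)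
    _ ≤ _ := by rw [one_mul]; simp only [neg_mul] at *; linarith

end Kernel

section Chaining

variable {Ω : Type*} [MeasurableSpace Ω] {d : ℕ}

theorem norm_euclideanSpace_le_sum (z : Ed d) : ‖z‖ ≤ ∑ l, |z l| := by
  refine abs_le_of_sq_le_sq' ?_ (Finset.sum_nonneg fun _ _ => abs_nonneg _) |>.2
  rw [EuclideanSpace.norm_sq_eq]
  exact Finset.sum_sq_le_sq_sum_of_nonneg fun _ _ => norm_nonneg _

theorem ae_eventually_forall_abs_le (P : Measure Ω) {T C D r : ℝ} {m : ℕ}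
    (hC : 0 ≤ C) (hD : 0 ≤ D) (hr : 0 ≤ r)
    (hrm : r ^ m ≤ (1 / 2) ^ ((d + 2) * (d + 1) + 1)) (G : ℕ → Ed d → ℝ → Ω → ℝ)
    (htail : ∀ n x, ∀ t ∈ Icc 0 T, P {ω | r ^ n ≤ |G n x t ω|} ≤ ENNReal.ofReal (C * (r ^ n) ^ m))
    (hlip : ∀ n ω x x', ∀ t ∈ Icc 0 T, ∀ t' ∈ Icc 0 T,
      |G n x t ω - G n x' t' ω| ≤ D * (2 ^ n) ^ (d + 1) * (‖x - x'‖ + |t - t'|)) (R : ℕ) :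
    ∀ᵐ ω ∂P, ∀ᶠ n in atTop, ∀ x : Ed d, (∀ l, |x l| ≤ R) → ∀ t ∈ Icc 0 T,
      |G n x t ω| ≤ r ^ n + D * (d + 1) * (1 / 2) ^ n := by
  classical
  set M : ℕ → ℕ := fun n => 2 ^ (n * (d + 2)) with hM
  have hM1 : ∀ n, 1 ≤ M n := fun n => Nat.one_le_two_pow
  have hM0 : ∀ n, (0 : ℝ) < M n := fun n => by exact_mod_cast hM1 n
  set grid : ℕ → Finset ((Fin d → ℤ) × ℕ) := fun n =>
    (Fintype.piFinset fun _ : Fin d => Finset.Icc (-(R * M n : ℤ)) (R * M n)) ×ˢ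
      (Finset.range (⌈T⌉₊ * M n + 1)).filter fun k : ℕ => (k : ℝ) / M n ∈ Icc 0 T with hgrid
  set pt : ℕ → (Fin d → ℤ) → Ed d := fun n k => WithLp.toLp 2 fun l => (k l : ℝ) / M n with hpt
  set bad : ℕ → Set Ω := fun n => ⋃ p ∈ grid n, {ω | r ^ n ≤ |G n (pt n p.1) (p.2 / M n) ω|}
    with hbad
  set K : ℝ := (2 * R + 1) ^ d * (⌈T⌉₊ + 1) with hK
  have hcard : ∀ n, ((grid n).card : ℝ) ≤ K * (2 ^ ((d + 2) * (d + 1))) ^ n := fun n => by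
    have h1 : (grid n).card ≤ ((2 * R + 1) * M n) ^ d * ((⌈T⌉₊ + 1) * M n) := by
      rw [hgrid, Finset.card_product]
      refine Nat.mul_le_mul ?_ ?_
      · rw [Fintype.card_piFinset_const, Int.card_Icc]
        refine Nat.pow_le_pow_left ?_ d
        have h2 : ((R : ℤ) * M n + 1 - -(R * M n)).toNat = 2 * (R * M n) + 1 := by omega
        rw [h2]
        nlinarith [hM1 n]
      · refine (Finset.card_filter_le _ _).trans ?_
        rw [Finset.card_range]
        nlinarith [hM1 n]
    calc ((grid n).card : ℝ) ≤ ((2 * R + 1) * M n) ^ d * ((⌈T⌉₊ + 1) * M n) := by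
          exact_mod_cast h1
      _ = K * (M n) ^ (d + 1) := by rw [hK, mul_pow]; ring
      _ = _ := by
          rw [hM]
          push_cast
          rw [← pow_mul, ← pow_mul]
          congr 2
          ring
  have hbadle : ∀ n, P (bad n) ≤ ENNReal.ofReal (K * C * (1 / 2) ^ n) := fun n => by
    calc P (bad n) ≤ ∑ p ∈ grid n, P {ω | r ^ n ≤ |G n (pt n p.1) (p.2 / M n) ω|} :=
          measure_biUnion_finset_le _ _
      _ ≤ ∑ _p ∈ grid n, ENNReal.ofReal (C * (r ^ n) ^ m) := by
          refine Finset.sum_le_sum fun p hp => htail n _ _ ?_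
          rw [hgrid, Finset.mem_product, Finset.mem_filter] at hp
          exact hp.2.2
      _ = ENNReal.ofReal ((grid n).card * (C * (r ^ n) ^ m)) := by
          rw [Finset.sum_const, nsmul_eq_mul, ENNReal.ofReal_mul (Nat.cast_nonneg _),
            ENNReal.ofReal_natCast]
      _ ≤ _ := by
          refine ENNReal.ofReal_le_ofReal ?_
          calc ((grid n).card : ℝ) * (C * (r ^ n) ^ m)
              ≤ (K * (2 ^ ((d + 2) * (d + 1))) ^ n) *
                  (C * ((1 / 2) ^ ((d + 2) * (d + 1) + 1)) ^ n) := by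
                rw [← pow_mul, mul_comm n m, pow_mul]
                have := hcard n
                gcongr
            _ = K * C * (1 / 2) ^ n := by
                rw [pow_succ, mul_pow, one_div, inv_pow 2 ((d + 2) * (d + 1)), inv_pow _ n]
                field_simp
  have hsum : ∑' n, P (bad n) ≠ ⊤ := by
    refine ne_top_of_le_ne_top ?_ (ENNReal.tsum_le_tsum hbadle)
    have hs : Summable fun n : ℕ => K * C * (1 / 2 : ℝ) ^ n :=
      (summable_geometric_of_lt_one (by norm_num) (by norm_num)).mul_left _
    rw [← ENNReal.ofReal_tsum_of_nonneg (fun n => by positivity) hs]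
    exact ENNReal.ofReal_ne_top
  filter_upwards [ae_eventually_notMem hsum] with ω hω
  filter_upwards [hω] with n hn x hx t ht
  set k : Fin d → ℤ := fun l => ⌊x l * M n⌋ with hk
  set j : ℕ := ⌊t * M n⌋₊ with hj
  have htM : 0 ≤ t * M n := mul_nonneg ht.1 (hM0 n).le
  have hjt : (j : ℝ) / M n ≤ t := by
    rw [div_le_iff₀ (hM0 n)]
    exact Nat.floor_le htM
  have hjT : (j : ℝ) / M n ∈ Icc 0 T := ⟨by positivity, hjt.trans ht.2⟩
  have hmem : (k, j) ∈ grid n := by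
    rw [hgrid, Finset.mem_product, Finset.mem_filter, Fintype.mem_piFinset, Finset.mem_range]
    refine ⟨fun l => ?_, ?_, hjT⟩
    · have hxl := abs_le.1 (hx l)
      rw [Finset.mem_Icc]
      constructor
      · rw [hk, Int.le_floor]
        push_cast
        rw [← neg_mul]
        exact mul_le_mul_of_nonneg_right hxl.1 (hM0 n).le
      · have : (k l : ℝ) ≤ R * M n :=
          (Int.floor_le _).trans (mul_le_mul_of_nonneg_right hxl.2 (hM0 n).le)
        exact_mod_cast this
    · have : (j : ℝ) ≤ ⌈T⌉₊ * M n := (Nat.floor_le htM).trans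
        (mul_le_mul_of_nonneg_right (ht.2.trans (Nat.le_ceil T)) (hM0 n).le)
      have : j ≤ ⌈T⌉₊ * M n := by exact_mod_cast this
      exact Nat.lt_succ_of_le this
  have hgood : |G n (pt n k) (j / M n) ω| ≤ r ^ n := by
    by_contra! hcon
    exact hn (mem_biUnion (x := (k, j)) hmem hcon.le)
  have hspace : ‖x - pt n k‖ ≤ d * (M n : ℝ)⁻¹ := by
    refine (norm_euclideanSpace_le_sum _).trans ?_
    calc ∑ l, |(x - pt n k) l| ≤ ∑ _l : Fin d, (M n : ℝ)⁻¹ := by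
          refine Finset.sum_le_sum fun l _ => ?_
          have h1 : (x - pt n k) l = (x l * M n - k l) * (M n : ℝ)⁻¹ := by
            simp only [hpt, PiLp.sub_apply]
            have := (hM0 n).ne'
            field_simp
          rw [h1, abs_mul, abs_of_pos (inv_pos.2 (hM0 n))]
          refine mul_le_of_le_one_left (inv_pos.2 (hM0 n)).le ?_
          rw [abs_le]
          constructor <;> linarith [Int.floor_le (x l * M n), Int.lt_floor_add_one (x l * M n)]
      _ = d * (M n : ℝ)⁻¹ := by simp
  have htime : |t - j / M n| ≤ (M n : ℝ)⁻¹ := by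
    rw [abs_of_nonneg (sub_nonneg.2 hjt), sub_le_iff_le_add, ← one_div, ← add_div,
      le_div_iff₀ (hM0 n)]
    linarith [Nat.lt_floor_add_one (t * M n)]
  have hstep := hlip n ω x (pt n k) t ht _ hjT
  have hscale : ((2 : ℝ) ^ n) ^ (d + 1) * (M n : ℝ)⁻¹ = (1 / 2) ^ n := by
    rw [hM]
    push_cast
    rw [← pow_mul, one_div, inv_pow, show n * (d + 2) = n * (d + 1) + n by ring, pow_add]
    field_simp
  calc |G n x t ω| = |G n (pt n k) (j / M n) ω + (G n x t ω - G n (pt n k) (j / M n) ω)| := by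
        congr 1; ring
    _ ≤ |G n (pt n k) (j / M n) ω| + |G n x t ω - G n (pt n k) (j / M n) ω| := abs_add_le _ _
    _ ≤ r ^ n + D * (2 ^ n) ^ (d + 1) * (d * (M n : ℝ)⁻¹ + (M n : ℝ)⁻¹) := by
        refine add_le_add hgood (hstep.trans ?_)
        gcongr
    _ = r ^ n + D * (d + 1) * (((2 : ℝ) ^ n) ^ (d + 1) * (M n : ℝ)⁻¹) := by ring
    _ = _ := by rw [hscale]

end Chaining

section SmoothedLocalTime

variable {d : ℕ}

/-- The occupation integral of the rescaled heat kernel centred at `x` along the path `y`. -/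
def smoothedLT (N : ℝ) (y : ℝ → Ed d) (x : Ed d) (t : ℝ) : ℝ :=
  ∫ s in (0 : ℝ)..t, scaledKernel N (y s - x)

variable {y : ℝ → Ed d}

theorem continuous_scaledKernel_path (N : ℝ) (hy : Continuous y) (x : Ed d) :
    Continuous fun s => scaledKernel N (y s - x) :=
  (continuous_scaledKernel N).comp (hy.sub continuous_const)

theorem smoothedLT_nonneg {N : ℝ} (hN : 0 ≤ N) (x : Ed d) {t : ℝ} (ht : 0 ≤ t) :
    0 ≤ smoothedLT N y x t :=
  intervalIntegral.integral_nonneg ht fun _ _ => scaledKernel_nonneg hN _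

theorem abs_smoothedLT_sub_le {N T : ℝ} (hN : 0 ≤ N) (hy : Continuous y) (x x' : Ed d) {t t' : ℝ}
    (ht : t ∈ Icc 0 T) :
    |smoothedLT N y x t - smoothedLT N y x' t'| ≤
      T * N ^ (d + 1) * ‖x - x'‖ + N ^ d * |t - t'| := by
  have hi := fun (x : Ed d) (a b : ℝ) =>
    (continuous_scaledKernel_path N hy x).intervalIntegrable (μ := volume) a b
  have hsplit : smoothedLT N y x t - smoothedLT N y x' t' =
      (∫ s in (0 : ℝ)..t, (scaledKernel N (y s - x) - scaledKernel N (y s - x'))) +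
        ∫ s in t'..t, scaledKernel N (y s - x') := by
    rw [intervalIntegral.integral_sub (hi _ _ _) (hi _ _ _),
      ← intervalIntegral.integral_add_adjacent_intervals (hi x' 0 t') (hi x' t' t)]
    unfold smoothedLT
    ring
  rw [hsplit]
  have hdiff : ∀ s, ‖scaledKernel N (y s - x) - scaledKernel N (y s - x')‖ ≤
      N ^ (d + 1) * ‖x - x'‖ := fun s => by
    refine (abs_scaledKernel_sub_le hN _ _).trans (le_of_eq ?_)
    rw [sub_sub_sub_cancel_left, norm_sub_rev]
  refine (abs_add_le _ _).trans (add_le_add ?_ ?_)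
  · have := intervalIntegral.norm_integral_le_of_norm_le_const (a := 0) (b := t)
      fun s _ => hdiff s
    rw [Real.norm_eq_abs, sub_zero, abs_of_nonneg ht.1] at this
    refine this.trans ?_
    calc _ ≤ N ^ (d + 1) * ‖x - x'‖ * T := by
          exact mul_le_mul_of_nonneg_left ht.2 (by positivity)
      _ = _ := by ring
  · exact intervalIntegral.norm_integral_le_of_norm_le_const fun s _ =>
      (Real.norm_of_nonneg (scaledKernel_nonneg hN (y s - x'))).trans_le (scaledKernel_le hN _)

theorem continuousOn_smoothedLT {N : ℝ} (T : ℝ) (hN : 0 ≤ N) (hy : Continuous y) :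
    ContinuousOn (fun q : Ed d × ℝ => smoothedLT N y q.1 q.2) (univ ×ˢ Icc 0 T) := by
  rintro ⟨x, t⟩ ⟨-, ht⟩
  rw [ContinuousWithinAt, tendsto_iff_norm_sub_tendsto_zero]
  have hlim : Tendsto (fun q : Ed d × ℝ => T * N ^ (d + 1) * ‖q.1 - x‖ + N ^ d * |q.2 - t|)
      (𝓝[univ ×ˢ Icc 0 T] (x, t)) (𝓝 0) := by
    have : Continuous fun q : Ed d × ℝ =>
        T * N ^ (d + 1) * ‖q.1 - x‖ + N ^ d * |q.2 - t| := by fun_prop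
    simpa using (this.tendsto (x, t)).mono_left nhdsWithin_le_nhds
  refine squeeze_zero' (Eventually.of_forall fun _ => norm_nonneg _) ?_ hlim
  filter_upwards [self_mem_nhdsWithin] with q hq
  exact abs_smoothedLT_sub_le hN hy _ _ hq.2

theorem integral_mul_scaledKernel {N : ℝ} (hN : 0 < N) (h : Ed d → ℝ) (z : Ed d) :
    ∫ x, h x * scaledKernel N (z - x) = ∫ w, h (z - N⁻¹ • w) * gaussKernel w := by
  rw [← integral_sub_left_eq_self (fun x => h x * scaledKernel N (z - x)) volume z]
  simp only [sub_sub_cancel]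
  have key := Measure.integral_comp_smul (volume : Measure (Ed d))
    (fun w => h (z - N⁻¹ • w) * gaussKernel w) N
  simp only [smul_smul, inv_mul_cancel₀ hN.ne', one_smul, finrank_euclideanSpace_fin] at key
  unfold scaledKernel
  calc ∫ x, h (z - x) * (N ^ d * gaussKernel (N • x))
      = N ^ d * ∫ x, h (z - x) * gaussKernel (N • x) := by
        rw [← integral_const_mul]
        congr 1
        ext x
        ring
    _ = _ := by
        rw [key, smul_eq_mul, abs_of_pos (by positivity), ← mul_assoc,
          mul_inv_cancel₀ (by positivity), one_mul]

theorem tendsto_integral_mul_scaledKernel {N : ℕ → ℝ} (hN : ∀ n, 0 < N n)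
    (hNlim : Tendsto N atTop atTop) {h : Ed d → ℝ} (hc : Continuous h) {B : ℝ}
    (hB : ∀ x, ‖h x‖ ≤ B) (z : Ed d) :
    Tendsto (fun n => ∫ x, h x * scaledKernel (N n) (z - x)) atTop (𝓝 (h z)) := by
  simp only [fun n => integral_mul_scaledKernel (hN n) h z]
  have hz : h z = ∫ w : Ed d, h z * gaussKernel w := by
    rw [integral_const_mul, integral_gaussKernel, mul_one]
  rw [hz]
  refine tendsto_integral_of_dominated_convergence (fun w => B * gaussKernel w) (fun n => ?_)
    (integrable_gaussKernel.const_mul B) (fun n => Eventually.of_forall fun w => ?_)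
    (Eventually.of_forall fun w => ?_)
  · exact ((hc.comp (by fun_prop)).mul continuous_gaussKernel).aestronglyMeasurable
  · rw [norm_mul, Real.norm_of_nonneg (gaussKernel_nonneg w)]
    exact mul_le_mul_of_nonneg_right (hB _) (gaussKernel_nonneg w)
  · refine Tendsto.mul_const _ ((hc.tendsto z).comp ?_)
    have : Tendsto (fun n => (N n)⁻¹ • w) atTop (𝓝 ((0 : ℝ) • w)) :=
      (tendsto_inv_atTop_zero.comp hNlim).smul_const w
    simpa using tendsto_const_nhds.sub this

theorem tendsto_integral_mul_smoothedLT {N : ℕ → ℝ} (hN : ∀ n, 0 < N n)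
    (hNlim : Tendsto N atTop atTop) (hy : Continuous y) {h : Ed d → ℝ} (hc : Continuous h)
    (hs : HasCompactSupport h) {t : ℝ} (ht : 0 ≤ t) :
    Tendsto (fun n => ∫ x, h x * smoothedLT (N n) y x t) atTop
      (𝓝 (∫ s in Ioc 0 t, h (y s))) := by
  obtain ⟨B, hB⟩ := hc.bounded_above_of_compact_support hs
  have hjoint : ∀ n, Continuous fun p : Ed d × ℝ => h p.1 * scaledKernel (N n) (y p.2 - p.1) :=
    fun n => (hc.comp continuous_fst).mul ((continuous_scaledKernel _).comp (by fun_prop))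
  have hswap : ∀ n, ∫ x, h x * smoothedLT (N n) y x t =
      ∫ s in Ioc 0 t, ∫ x, h x * scaledKernel (N n) (y s - x) := fun n => by
    rw [integral_integral_swap]
    · congr 1
      ext x
      rw [integral_const_mul, smoothedLT, intervalIntegral.integral_of_le ht]
    · have hint : Integrable (fun p : ℝ × Ed d => (1 : ℝ) * (‖h p.2‖ * N n ^ d))
          ((volume.restrict (Ioc 0 t)).prod volume) :=
        (integrable_const (1 : ℝ)).mul_prod
          ((hc.integrable_of_hasCompactSupport hs).norm.mul_const _)
      refine hint.mono' ?_ (Eventually.of_forall fun p => ?_)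
      · exact ((hjoint n).comp continuous_swap).aestronglyMeasurable
      · rw [one_mul, Function.uncurry, norm_mul, Real.norm_of_nonneg (scaledKernel_nonneg
          (hN n).le _)]
        exact mul_le_mul_of_nonneg_left (scaledKernel_le (hN n).le _) (norm_nonneg _)
  simp only [hswap]
  refine tendsto_integral_of_dominated_convergence (fun _ => B) (fun n => ?_)
    (integrable_const B) (fun n => Eventually.of_forall fun s => ?_)
    (Eventually.of_forall fun s => tendsto_integral_mul_scaledKernel hN hNlim hc hB _)
  · exact (StronglyMeasurable.integral_prod_left (f := fun x s => h x * scaledKernel (N n) (y s - x))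
      (hjoint n).stronglyMeasurable).aestronglyMeasurable
  · rw [integral_mul_scaledKernel (hN n)]
    calc _ ≤ ∫ w : Ed d, B * gaussKernel w :=
          norm_integral_le_of_norm_le (integrable_gaussKernel.const_mul B)
            (Eventually.of_forall fun w => by
              rw [norm_mul, Real.norm_of_nonneg (gaussKernel_nonneg w)]
              exact mul_le_mul_of_nonneg_right (hB _) (gaussKernel_nonneg w))
      _ = B := by rw [integral_const_mul, integral_gaussKernel, mul_one]

end SmoothedLocalTime

section OccupationDensity

variable {d : ℕ} {y : ℝ → Ed d}

theorem map_restrict_eq_withDensity (hy : Continuous y) {t : ℝ} (ht : 0 ≤ t) {N : ℕ → ℝ}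
    (hN : ∀ n, 0 < N n) (hNlim : Tendsto N atTop atTop) {ℓ : Ed d → ℝ} (hℓ : Continuous ℓ)
    (hlim : ∀ R : ℕ, TendstoUniformlyOn (fun n x => smoothedLT (N n) y x t) ℓ atTop
      {x | ∀ l, |x l| < R}) :
    (volume.restrict (Ioc 0 t)).map y = volume.withDensity fun x => ENNReal.ofReal (ℓ x) := by
  have hcover : ∀ K : Set (Ed d), Bornology.IsBounded K → ∃ R : ℕ, K ⊆ {x | ∀ l, |x l| < R} := by
    intro K hK
    obtain ⟨r, hr⟩ := hK.subset_ball 0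
    obtain ⟨R, hR⟩ := exists_nat_ge r
    refine ⟨R, fun x hx l => ?_⟩
    have h1 : ‖x‖ < r := by simpa using hr hx
    exact ((PiLp.norm_apply_le x l).trans_lt h1).trans_le hR
  have hpt : ∀ x, Tendsto (fun n => smoothedLT (N n) y x t) atTop (𝓝 (ℓ x)) := fun x => by
    obtain ⟨R, hR⟩ := hcover {x} Bornology.isBounded_singleton
    exact (hlim R).tendsto_at (hR rfl)
  have hℓ0 : ∀ x, 0 ≤ ℓ x := fun x =>
    ge_of_tendsto' (hpt x) fun n => smoothedLT_nonneg (hN n).le x ht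
  have hF : ∀ n, Continuous fun x => smoothedLT (N n) y x t := fun n =>
    (continuousOn_smoothedLT t (hN n).le hy).comp_continuous (f := fun x : Ed d => (x, t))
      (by fun_prop) fun x => ⟨mem_univ _, ht, le_rfl⟩
  have := IsLocallyFiniteMeasure.withDensity_ofReal (μ := (volume : Measure (Ed d))) hℓ
  refine Measure.ext_of_integral_eq_on_compactlySupported fun h => ?_
  have hc : Continuous h := h.continuous
  have hs : HasCompactSupport h := h.hasCompactSupport
  rw [integral_map hy.aemeasurable hc.aestronglyMeasurable,
    integral_withDensity_eq_integral_toReal_smul (by fun_prop)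
      (Eventually.of_forall fun x => ENNReal.ofReal_lt_top)]
  simp only [ENNReal.toReal_ofReal (hℓ0 _), smul_eq_mul]
  refine tendsto_nhds_unique (tendsto_integral_mul_smoothedLT hN hNlim hy hc hs ht) ?_
  obtain ⟨R, hR⟩ := hcover (tsupport h) hs.isCompact.isBounded
  refine tendsto_integral_filter_of_dominated_convergence (fun x => ‖h x‖ * (ℓ x + 1))
    (Eventually.of_forall fun n => (hc.mul (hF n)).aestronglyMeasurable) ?_ ?_
    (Eventually.of_forall fun x => ?_)
  · filter_upwards [Metric.tendstoUniformlyOn_iff.1 (hlim R) 1 one_pos] with n hn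
    refine Eventually.of_forall fun x => ?_
    rw [norm_mul]
    by_cases hx : x ∈ tsupport h
    · refine mul_le_mul_of_nonneg_left ?_ (norm_nonneg _)
      rw [Real.norm_of_nonneg (smoothedLT_nonneg (hN n).le x ht)]
      have := hn x (hR hx)
      rw [Real.dist_eq] at this
      linarith [(abs_lt.1 this).1]
    · simp [image_eq_zero_of_notMem_tsupport hx]
  · exact Continuous.integrable_of_hasCompactSupport (by fun_prop) (hs.norm.mul_right)
  · rw [mul_comm (ℓ x)]
    exact (hpt x).const_mul (h x)

theorem exists_continuous_occupation_density (hy : Continuous y) {T : ℝ} {b : ℕ → ℝ}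
    (hb : Summable b)
    (hstep : ∀ R : ℕ, ∀ᶠ n : ℕ in atTop, ∀ x : Ed d, (∀ l, |x l| ≤ R) → ∀ t ∈ Icc 0 T,
      |smoothedLT (2 ^ (n + 1)) y x t - smoothedLT (2 ^ n) y x t| ≤ b n) :
    ∃ L : Ed d → ℝ → ℝ,
      ContinuousOn (fun q : Ed d × ℝ => L q.1 q.2) (univ ×ˢ Icc 0 T) ∧
      ∀ t ∈ Icc (0 : ℝ) T, ∀ A : Set (Ed d), MeasurableSet A →
        volume (Icc 0 t ∩ {u | y u ∈ A}) = ENNReal.ofReal (∫ x in A, L x t) := by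
  set F : ℕ → Ed d × ℝ → ℝ := fun n q => smoothedLT (2 ^ n) y q.1 q.2 with hF
  set L : Ed d × ℝ → ℝ := fun q => F 0 q + ∑' n, (F (n + 1) q - F n q) with hL
  have hunif : ∀ R : ℕ, TendstoUniformlyOn F L atTop ({x : Ed d | ∀ l, |x l| < R} ×ˢ Icc 0 T) := by
    intro R
    have h1 : TendstoUniformlyOn (fun n q => ∑ k ∈ Finset.range n, (F (k + 1) q - F k q))
        (fun q => ∑' n, (F (n + 1) q - F n q)) atTop ({x : Ed d | ∀ l, |x l| < R} ×ˢ Icc 0 T) := by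
      refine tendstoUniformlyOn_tsum_nat_eventually hb ?_
      filter_upwards [hstep R] with n hn q hq
      exact hn q.1 (fun l => (hq.1 l).le) q.2 hq.2
    rw [Metric.tendstoUniformlyOn_iff] at h1 ⊢
    intro ε hε
    filter_upwards [h1 ε hε] with n hn q hq
    have := hn q hq
    rw [Finset.sum_range_sub (fun k => F k q)] at this
    rw [Real.dist_eq] at this ⊢
    rw [hL]
    convert this using 2
    ring
  have hopen : ∀ R : ℕ, IsOpen {x : Ed d | ∀ l, |x l| < R} := fun R => by
    simp only [ofPred_forall]
    exact isOpen_iInter_of_finite fun l => isOpen_lt (by fun_prop) continuous_const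
  have hcont : ContinuousOn L (univ ×ˢ Icc 0 T) := by
    rintro ⟨x, t⟩ hxt
    obtain ⟨R, hR⟩ := exists_nat_gt ‖x‖
    have hx : x ∈ {x : Ed d | ∀ l, |x l| < R} := fun l => (PiLp.norm_apply_le x l).trans_lt hR
    have h1 : ContinuousOn L ({x : Ed d | ∀ l, |x l| < R} ×ˢ Icc 0 T) :=
      (hunif R).continuousOn (Eventually.of_forall fun n =>
        (continuousOn_smoothedLT T (by positivity) hy).mono
          (prod_mono (subset_univ _) le_rfl)).frequently
    refine (h1 (x, t) ⟨hx, hxt.2⟩).mono_of_mem_nhdsWithin ?_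
    rw [nhdsWithin_prod_eq]
    refine prod_mem_prod ?_ self_mem_nhdsWithin
    exact mem_nhdsWithin_of_mem_nhds ((hopen R).mem_nhds hx)
  refine ⟨fun x t => L (x, t), hcont, fun t ht A hA => ?_⟩
  have hℓ : Continuous fun x => L (x, t) :=
    hcont.comp_continuous (by fun_prop) fun x => ⟨mem_univ _, ht⟩
  have hmap := map_restrict_eq_withDensity hy ht.1 (N := fun n => 2 ^ n) (fun n => by positivity)
    (tendsto_pow_atTop_atTop_of_one_lt one_lt_two) hℓ fun R => by
      have := (hunif R).comp fun x : Ed d => (x, t)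
      exact this.mono fun x hx => ⟨hx, ht⟩
  have hℓ0 : ∀ x, 0 ≤ L (x, t) := fun x => by
    obtain ⟨R, hR⟩ := exists_nat_gt ‖x‖
    exact ge_of_tendsto' ((hunif R).tendsto_at (x := (x, t))
      ⟨fun l => (PiLp.norm_apply_le x l).trans_lt hR, ht⟩)
      fun n => smoothedLT_nonneg (by positivity) x ht.1
  have hvol : volume (Icc 0 t ∩ {u | y u ∈ A}) = ∫⁻ x in A, ENNReal.ofReal (L (x, t)) := by
    rw [← withDensity_apply _ hA, ← hmap, Measure.map_apply hy.measurable hA,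
      Measure.restrict_congr_set Ioc_ae_eq_Icc,
      Measure.restrict_apply (hy.measurable hA), inter_comm]
    rfl
  rw [hvol, ← ofReal_integral_eq_lintegral_ofReal _ (Eventually.of_forall hℓ0)]
  refine ⟨hℓ.aestronglyMeasurable, ?_⟩
  rw [hasFiniteIntegral_iff_ofReal (Eventually.of_forall hℓ0), ← hvol]
  exact (measure_mono inter_subset_left).trans_lt measure_Icc_lt_top

end OccupationDensity

section Assembly

variable {Ω : Type*} [MeasurableSpace Ω] {d : ℕ}

theorem exists_summable_ae_eventually_step_le (P : Measure Ω) [IsProbabilityMeasure P]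
    (Y : ℝ → Ω → Ed d) (hY : ∀ t, Measurable (Y t)) (hYc : ∀ ω, Continuous fun t => Y t ω)
    {T α : ℝ} (hT : 0 < T) (hα : 0 < α) (hαd : d * α < 1) (hchar : CharDecay P Y T α) :
    ∃ b : ℕ → ℝ, Summable b ∧ ∀ᵐ ω ∂P, ∀ R : ℕ, ∀ᶠ n : ℕ in atTop,
      ∀ x : Ed d, (∀ l, |x l| ≤ R) → ∀ t ∈ Icc 0 T,
        |smoothedLT (2 ^ (n + 1)) (fun s => Y s ω) x t -
          smoothedLT (2 ^ n) (fun s => Y s ω) x t| ≤ b n := by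
  have hdα : 0 ≤ d * α := by positivity
  set δ : ℝ := (1 - d * α) / 4 with hδdef
  have hδ : 0 < δ := by rw [hδdef]; linarith
  have hδ4 : δ ≤ 1 / 4 := by rw [hδdef]; linarith
  have hαδ : d * (α * (1 + 2 * δ)) < 1 := by
    rw [hδdef]
    nlinarith
  set r : ℝ := (1 / 2) ^ (δ / 2) with hr
  have hr0 : 0 < r := by positivity
  have hr1 : r < 1 := Real.rpow_lt_one (by norm_num) (by norm_num) (by positivity)
  obtain ⟨k, hk⟩ := exists_pow_lt_of_lt_one
    (show (0 : ℝ) < (1 / 2) ^ ((d + 2) * (d + 1) + 1) by positivity) hr1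
  have hrm : r ^ (2 * (k + 1)) ≤ (1 / 2) ^ ((d + 2) * (d + 1) + 1) :=
    (pow_le_pow_of_le_one hr0.le hr1.le (by omega)).trans hk.le
  obtain ⟨C, hC, htail⟩ := exists_tail_bound P Y hY hYc hT hα hδ.le (by linarith) hαδ
    (show 0 < 2 * (k + 1) by omega) (even_two_mul _) hchar
  have hamp : ∀ n : ℕ, ((2 ^ n : ℝ)⁻¹) ^ δ = r ^ n * r ^ n := fun n => by
    rw [hr, ← mul_pow, ← Real.rpow_add (by norm_num), add_halves, ← inv_pow, ← one_div,
      Real.rpow_pow_comm (by norm_num)]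
  have hcK := fun (N : ℝ) (x : Ed d) (ω : Ω) (a b : ℝ) =>
    (continuous_scaledKernel_path N (hYc ω) x).intervalIntegrable (μ := volume) a b
  refine ⟨fun n => r ^ n + 2 ^ (d + 2) * (T + 1) * (d + 1) * (1 / 2) ^ n,
    (summable_geometric_of_lt_one hr0.le hr1).add
      ((summable_geometric_of_lt_one (by norm_num) (by norm_num)).mul_left _), ?_⟩
  refine ae_all_iff.2 (ae_eventually_forall_abs_le P hC (by positivity) hr0.le hrm
    (fun n x t ω => smoothedLT (2 ^ (n + 1)) (fun s => Y s ω) x t -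
          smoothedLT (2 ^ n) (fun s => Y s ω) x t) ?_ ?_)
  · intro n x t ht
    have hN : (0 : ℝ) < 2 ^ n := by positivity
    have hN' : (0 : ℝ) < 2 ^ (n + 1) := by positivity
    have hle : (2 : ℝ) ^ n ≤ 2 ^ (n + 1) := pow_le_pow_right₀ one_le_two (Nat.le_succ n)
    have := htail (((2 ^ n : ℝ)⁻¹) ^ δ) (fun v => gaussAmp (2 ^ (n + 1)) v - gaussAmp (2 ^ n) v)
      (by positivity) ((continuous_gaussAmp _).sub (continuous_gaussAmp _))
      ((integrable_gaussAmp hN').sub (integrable_gaussAmp hN))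
      (abs_gaussAmp_sub_le hN hle hδ.le (by linarith))
      (fun y => scaledKernel (2 ^ (n + 1)) y - scaledKernel (2 ^ n) y)
      ((continuous_scaledKernel _).sub (continuous_scaledKernel _))
      ⟨(2 ^ (n + 1)) ^ d + (2 ^ n) ^ d, fun y => (norm_sub_le _ _).trans (add_le_add
        ((Real.norm_of_nonneg (scaledKernel_nonneg hN'.le y)).trans_le (scaledKernel_le hN'.le y))
        ((Real.norm_of_nonneg (scaledKernel_nonneg hN.le y)).trans_le (scaledKernel_le hN.le y)))⟩
      (fun y => by
        rw [Complex.ofReal_sub, scaledKernel_eq_integral hN', scaledKernel_eq_integral hN,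
          ← integral_sub (integrable_gaussAmp_mul_cexp hN' y) (integrable_gaussAmp_mul_cexp hN y)]
        simp only [Complex.ofReal_sub, sub_mul])
      x t ht (r ^ n) (by positivity)
    rw [hamp, mul_div_assoc, div_self (by positivity), mul_one] at this
    convert this using 6 with ω
    exact (intervalIntegral.integral_sub (hcK _ _ _ _ _) (hcK _ _ _ _ _)).symm
  · intro n ω x x' t ht t' _
    set N : ℝ := 2 ^ n with hNdef
    have hN1 : 1 ≤ N := one_le_pow₀ one_le_two
    have h1 := abs_smoothedLT_sub_le (N := 2 ^ (n + 1)) (by positivity) (hYc ω) x x' (t' := t') ht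
    have h2 := abs_smoothedLT_sub_le (N := N) (by positivity) (hYc ω) x x' (t' := t') ht
    have e1 : ((2 : ℝ) ^ (n + 1)) ^ (d + 1) = 2 ^ (d + 1) * N ^ (d + 1) := by
      rw [hNdef, pow_succ 2 n, mul_pow, mul_comm]
    have e2 : ((2 : ℝ) ^ (n + 1)) ^ d ≤ 2 ^ (d + 1) * N ^ (d + 1) := by
      rw [← e1]
      exact pow_le_pow_right₀ (one_le_pow₀ one_le_two) (Nat.le_succ d)
    have e3 : N ^ (d + 1) ≤ 2 ^ (d + 1) * N ^ (d + 1) :=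
      le_mul_of_one_le_left (by positivity) (one_le_pow₀ one_le_two)
    have e4 : N ^ d ≤ 2 ^ (d + 1) * N ^ (d + 1) :=
      (pow_le_pow_right₀ hN1 (Nat.le_succ d)).trans e3
    rw [e1] at h1
    set Q := (2 : ℝ) ^ (d + 1) * N ^ (d + 1) with hQ
    have hQ0 : 0 ≤ Q := by positivity
    have ha := norm_nonneg (x - x')
    have hb := abs_nonneg (t - t')
    have h3 : T * N ^ (d + 1) * ‖x - x'‖ ≤ T * Q * ‖x - x'‖ := by gcongr
    have h4 := mul_le_mul_of_nonneg_right e2 hb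
    have h5 := mul_le_mul_of_nonneg_right e4 hb
    rw [sub_sub_sub_comm]
    refine (abs_sub _ _).trans ?_
    calc _ ≤ (T * Q * ‖x - x'‖ + Q * |t - t'|) + (T * Q * ‖x - x'‖ + Q * |t - t'|) := by linarith
      _ ≤ 2 * Q * ((T + 1) * (‖x - x'‖ + |t - t'|)) := by
        nlinarith [mul_nonneg hQ0 ha, mul_nonneg (mul_nonneg hT.le hQ0) hb]
      _ = _ := by rw [hQ]; ring

theorem exists_continuous_modification (P : Measure Ω) {T : ℝ} (hT : 0 ≤ T) (X : ℝ → Ω → Ed d)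
    (hmeas : ∀ t, Measurable (X t))
    (hpath : ∀ᵐ ω ∂P, ContinuousOn (fun u => X u ω) (Icc 0 T)) :
    ∃ Y : ℝ → Ω → Ed d, (∀ t, Measurable (Y t)) ∧ (∀ ω, Continuous fun t => Y t ω) ∧
      ∀ᵐ ω ∂P, ∀ t ∈ Icc 0 T, Y t ω = X t ω - X 0 ω := by
  obtain ⟨S, hSsub, hSm, hS⟩ := exists_measurable_superset_of_null (ae_iff.1 hpath)
  refine ⟨fun t => Sᶜ.indicator fun ω => X (projIcc 0 T hT t) ω - X 0 ω,
    fun t => ((hmeas _).sub (hmeas 0)).indicator hSm.compl, fun ω => ?_, ?_⟩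
  · by_cases hω : ω ∈ Sᶜ
    · simp only [indicator_of_mem hω]
      have hc : ContinuousOn (fun u => X u ω) (Icc 0 T) := by
        by_contra h
        exact hω (hSsub h)
      exact (hc.comp_continuous (continuous_subtype_val.comp continuous_projIcc)
        fun t => (projIcc 0 T hT t).2).sub continuous_const
    · simp only [indicator_of_notMem hω]
      exact continuous_const
  · filter_upwards [measure_eq_zero_iff_ae_notMem.1 hS] with ω hω t ht
    rw [indicator_of_mem (show ω ∈ Sᶜ from hω), projIcc_of_mem hT ht]

end Assembly

/-- under (A1) and (A2), almost surely the occupation measure of every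
interval `[0,t]`, `t ∈ [0,T]`, is absolutely continuous w.r.t. Lebesgue measure, with a
density `L(x,t)` which is jointly continuous in `(x,t) ∈ ℝ^d × [0,T]`. -/
theorem localTime_exists_jointly_continuous
    {Ω : Type*} [MeasurableSpace Ω] (P : Measure Ω) [IsProbabilityMeasure P]
    {d : ℕ} (hd : 0 < d) (T : ℝ) (hT : 0 < T)
    (X : ℝ → Ω → Ed d) (hmeas : ∀ t : ℝ, Measurable (X t))
    (hpath : ∀ᵐ ω ∂P, ContinuousOn (fun u => X u ω) (Icc 0 T))
    (α θ ι : ℝ) (hα : 0 < α) (hαd : α < 1 / d) (hθ : 0 ≤ θ) (hι : ι ∈ Icc (0 : ℝ) 1)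
    (hA1 : CondA1 P X T α θ) (hA2 : CondA2 P X T α ι) :
    ∃ L : Ed d → ℝ → Ω → ℝ,
      ∀ᵐ ω ∂P,
        (ContinuousOn (fun q : Ed d × ℝ => L q.1 q.2 ω) (univ ×ˢ Icc 0 T)) ∧
        ∀ t ∈ Icc (0 : ℝ) T, ∀ A : Set (Ed d), MeasurableSet A →
          volume (Icc 0 t ∩ {u | X u ω ∈ A}) = ENNReal.ofReal (∫ x in A, L x t ω) := by
  obtain ⟨Y, hY, hYc, hXY⟩ := exists_continuous_modification P hT.le X hmeas hpath
  have hαd' : d * α < 1 := by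
    rw [lt_div_iff₀ (by exact_mod_cast hd)] at hαd
    linarith
  obtain ⟨b, hb, hstep⟩ := exists_summable_ae_eventually_step_le P Y hY hYc hT hα hαd'
    (hA1.charDecay hXY)
  have hdens : ∀ ω, ∃ L : Ed d → ℝ → ℝ,
      (∀ R : ℕ, ∀ᶠ n : ℕ in atTop, ∀ x : Ed d, (∀ l, |x l| ≤ R) → ∀ t ∈ Icc 0 T,
        |smoothedLT (2 ^ (n + 1)) (fun s => Y s ω) x t -
          smoothedLT (2 ^ n) (fun s => Y s ω) x t| ≤ b n) →
      ContinuousOn (fun q : Ed d × ℝ => L q.1 q.2) (univ ×ˢ Icc 0 T) ∧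
      ∀ t ∈ Icc (0 : ℝ) T, ∀ A : Set (Ed d), MeasurableSet A →
        volume (Icc 0 t ∩ {u | Y u ω ∈ A}) = ENNReal.ofReal (∫ x in A, L x t) := fun ω => by
    by_cases h : ∀ R : ℕ, ∀ᶠ n : ℕ in atTop, ∀ x : Ed d, (∀ l, |x l| ≤ R) → ∀ t ∈ Icc 0 T,
        |smoothedLT (2 ^ (n + 1)) (fun s => Y s ω) x t -
          smoothedLT (2 ^ n) (fun s => Y s ω) x t| ≤ b n
    · obtain ⟨L, hL⟩ := exists_continuous_occupation_density (hYc ω) hb h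
      exact ⟨L, fun _ => hL⟩
    · exact ⟨0, fun h' => absurd h' h⟩
  choose L hL using hdens
  refine ⟨fun x t ω => L ω (x - X 0 ω) t, ?_⟩
  filter_upwards [hXY, hstep] with ω hω hω'
  obtain ⟨hcont, hocc⟩ := hL ω hω'
  refine ⟨hcont.comp (f := fun q : Ed d × ℝ => (q.1 - X 0 ω, q.2)) (by fun_prop)
    fun q hq => ⟨mem_univ _, hq.2⟩, fun t ht A hA => ?_⟩
  have hset : Icc 0 t ∩ {u | X u ω ∈ A} = Icc 0 t ∩ {u | Y u ω ∈ (· + X 0 ω) ⁻¹' A} := by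
    ext u
    refine and_congr_right fun hu => ?_
    simp only [mem_ofPred_eq, mem_preimage]
    rw [hω u ⟨hu.1, hu.2.trans ht.2⟩, sub_add_cancel]
  rw [hset, hocc t ht _ (measurable_add_const _ hA),
    ← (measurePreserving_add_right volume (X 0 ω)).setIntegral_preimage_emb
      (measurableEmbedding_addRight _) (fun x => L ω (x - X 0 ω) t) A]
  simp only [add_sub_cancel_right]
end
end

section
/- Suppose X = (X_t)_{t∈[0,T]} has almost surely continuous sample paths in ℝ^d and satisfies conditions (A1) and (A2) for some α ∈ (0, 1/d), θ ≥ 0 and ι ∈ [0,1]. Then almost surely the sample path t ↦ X_t is nowhere differentiable on [0,T]; that is, almost surely there is no s ∈ [0,T] at which the ℝ^d-valued function t ↦ X_t has a (finite) derivative. -/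
open MeasureTheory Filter Topology Set RealInnerProductSpace

noncomputable section

theorem integral_pi_gaussianReal_cexp {κ : Type*} [Fintype κ] (z : κ → ℝ) :
    ∫ ξ : κ → ℝ, Complex.exp (Complex.I * ((∑ a, ξ a * z a : ℝ) : ℂ))
        ∂(Measure.pi fun _ : κ => ProbabilityTheory.gaussianReal 0 1) =
      ((∏ a, Real.exp (-(z a) ^ 2 / 2) : ℝ) : ℂ) := by
  have h (ξ : κ → ℝ) : Complex.exp (Complex.I * ((∑ a, ξ a * z a : ℝ) : ℂ)) =
      ∏ a, Complex.exp (z a * ξ a * Complex.I) := by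
    rw [← Complex.exp_sum]
    push_cast
    rw [Finset.mul_sum]
    congr 1
    exact Finset.sum_congr rfl fun a _ => by ring
  simp_rw [h]
  rw [integral_fintype_prod_eq_prod (fun a (x : ℝ) => Complex.exp (z a * x * Complex.I))]
  push_cast
  refine Finset.prod_congr rfl fun a _ => ?_
  rw [← charFun_apply_real, ProbabilityTheory.charFun_gaussianReal]
  congr 1
  push_cast
  ring

theorem integral_gaussianReal_le {r : ℝ} (hr : 0 < r) :
    ∫ x, 2 / (1 + (r * x) ^ 2) ∂(ProbabilityTheory.gaussianReal 0 1) ≤ 2 * Real.pi / r := by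
  rw [ProbabilityTheory.integral_gaussianReal_eq_integral_smul one_ne_zero]
  have hint : Integrable fun x : ℝ => 2 * (1 + (r * x) ^ 2)⁻¹ :=
    (integrable_inv_one_add_sq.comp_mul_left' hr.ne').const_mul 2
  have hval : ∫ x : ℝ, 2 * (1 + (r * x) ^ 2)⁻¹ = 2 * Real.pi / r := by
    rw [integral_const_mul, Measure.integral_comp_mul_left (fun x : ℝ => (1 + x ^ 2)⁻¹) r,
      integral_univ_inv_one_add_sq, abs_of_pos (inv_pos.2 hr), smul_eq_mul]
    ring
  rw [← hval]
  refine integral_mono_of_nonneg (ae_of_all _ fun x => ?_) hint (ae_of_all _ fun x => ?_)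
  · exact smul_nonneg (ProbabilityTheory.gaussianPDFReal_nonneg _ _ _) (by positivity)
  · have hpdf : ProbabilityTheory.gaussianPDFReal 0 1 x ≤ 1 := by
      rw [ProbabilityTheory.gaussianPDFReal_def]
      refine mul_le_one₀ (inv_le_one_of_one_le₀ ?_) (Real.exp_nonneg _) (Real.exp_le_one_iff.2 ?_)
      · rw [Real.one_le_sqrt]
        have := Real.pi_gt_three
        push_cast
        linarith
      · exact div_nonpos_of_nonpos_of_nonneg (by nlinarith [sq_nonneg (x - 0)]) (by positivity)
    simp only [smul_eq_mul, div_eq_mul_inv]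
    exact mul_le_of_le_one_left (by positivity) hpdf

/-- A small-ball estimate: polynomial decay of the joint characteristic function of finitely many
real random variables bounds the probability that all of them lie in `[-1, 1]`. -/
theorem measureReal_forall_abs_le_one_le {Ω : Type*} [MeasurableSpace Ω] (P : Measure Ω)
    [IsProbabilityMeasure P] {κ : Type*} [Fintype κ] {Z : κ → Ω → ℝ}
    (hZ : ∀ a, Measurable (Z a)) {D r : ℝ} (hD : 0 ≤ D) (hr : 0 < r)
    (h : ∀ ξ : κ → ℝ, (∀ a, ξ a ≠ 0) →
      ‖∫ ω, Complex.exp (Complex.I * ((∑ a, ξ a * Z a ω : ℝ) : ℂ)) ∂P‖ ≤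
        D * ∏ a, 2 / (1 + (r * ξ a) ^ 2)) :
    P.real {ω | ∀ a, |Z a ω| ≤ 1} ≤
      D * (Real.exp (1 / 2) * (2 * Real.pi / r)) ^ Fintype.card κ := by
  set γ : Measure (κ → ℝ) := Measure.pi fun _ : κ => ProbabilityTheory.gaussianReal 0 1 with hγ
  have hnz : ∀ᵐ ξ ∂γ, ∀ a, ξ a ≠ 0 := by
    rw [ae_all_iff]
    intro a
    have := ProbabilityTheory.nullSingletonClass_gaussianReal (μ := 0) (v := 1) one_ne_zero
    have h0 : ∀ᵐ x ∂(ProbabilityTheory.gaussianReal 0 1), x ≠ 0 := by simp [ae_iff]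
    exact (Measure.quasiMeasurePreserving_eval
      (fun _ : κ => ProbabilityTheory.gaussianReal 0 1) a).ae h0
  have hmeas : Measurable (Function.uncurry fun (ω : Ω) (ξ : κ → ℝ) =>
      Complex.exp (Complex.I * ((∑ a, ξ a * Z a ω : ℝ) : ℂ))) := by
    unfold Function.uncurry
    fun_prop
  have hnorm (x : ℝ) : ‖Complex.exp (Complex.I * (x : ℂ))‖ = 1 := by
    rw [mul_comm, Complex.norm_exp_ofReal_mul_I]
  have hint : Integrable (Function.uncurry fun (ω : Ω) (ξ : κ → ℝ) =>
      Complex.exp (Complex.I * ((∑ a, ξ a * Z a ω : ℝ) : ℂ))) (P.prod γ) :=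
    Integrable.of_bound hmeas.aestronglyMeasurable 1
      (ae_of_all _ fun p => (hnorm _).le)
  have hswap := integral_integral_swap hint
  simp_rw [hγ, integral_pi_gaussianReal_cexp, ← hγ] at hswap
  rw [integral_complex_ofReal] at hswap
  have hI : ∫ ω, ∏ a, Real.exp (-(Z a ω) ^ 2 / 2) ∂P ≤ D * (2 * Real.pi / r) ^ Fintype.card κ := by
    have hb : Integrable (fun ξ : κ → ℝ => ∏ a, 2 / (1 + (r * ξ a) ^ 2)) γ := by
      refine Integrable.of_bound (Measurable.aestronglyMeasurable (by fun_prop))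
        (2 ^ Fintype.card κ) (ae_of_all _ fun ξ => ?_)
      rw [Real.norm_of_nonneg (Finset.prod_nonneg fun a _ => by positivity),
        ← Finset.card_univ, ← Finset.prod_const]
      refine Finset.prod_le_prod (fun a _ => by positivity) fun a _ => ?_
      exact div_le_self zero_le_two (by nlinarith [sq_nonneg (r * ξ a)])
    calc ∫ ω, ∏ a, Real.exp (-(Z a ω) ^ 2 / 2) ∂P
        ≤ ‖((∫ ω, ∏ a, Real.exp (-(Z a ω) ^ 2 / 2) ∂P : ℝ) : ℂ)‖ := by
          rw [Complex.norm_real]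
          exact Real.le_norm_self _
      _ ≤ ∫ ξ, ‖∫ ω, Complex.exp (Complex.I * ((∑ a, ξ a * Z a ω : ℝ) : ℂ)) ∂P‖ ∂γ := by
          rw [hswap]
          exact norm_integral_le_integral_norm _
      _ ≤ ∫ ξ, D * ∏ a, 2 / (1 + (r * ξ a) ^ 2) ∂γ :=
          integral_mono_of_nonneg (ae_of_all _ fun ξ => norm_nonneg _) (hb.const_mul D)
            (hnz.mono h)
      _ ≤ D * (2 * Real.pi / r) ^ Fintype.card κ := by
          rw [integral_const_mul, hγ,
            integral_fintype_prod_eq_pow (fun x : ℝ => 2 / (1 + (r * x) ^ 2))]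
          refine mul_le_mul_of_nonneg_left (pow_le_pow_left₀ ?_ (integral_gaussianReal_le hr) _) hD
          exact integral_nonneg fun x => by positivity
  have hset : MeasurableSet {ω | ∀ a, |Z a ω| ≤ 1} := by
    rw [ofPred_forall]
    exact MeasurableSet.iInter fun a => measurableSet_le (hZ a).abs measurable_const
  calc P.real {ω | ∀ a, |Z a ω| ≤ 1}
      = ∫ ω, indicator {ω | ∀ a, |Z a ω| ≤ 1} 1 ω ∂P := (integral_indicator_one hset).symm
    _ ≤ ∫ ω, Real.exp (1 / 2) ^ Fintype.card κ * ∏ a, Real.exp (-(Z a ω) ^ 2 / 2) ∂P := by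
        refine integral_mono_of_nonneg (ae_of_all _ fun ω => indicator_nonneg (by simp) ω) ?_
          (ae_of_all _ fun ω => ?_)
        · refine (Integrable.of_bound (Measurable.aestronglyMeasurable (by fun_prop)) 1
            (ae_of_all _ fun ω => ?_)).const_mul _
          rw [Real.norm_of_nonneg (Finset.prod_nonneg fun a _ => Real.exp_nonneg _)]
          refine Finset.prod_le_one (fun a _ => Real.exp_nonneg _) fun a _ => ?_
          exact Real.exp_le_one_iff.2 (by nlinarith [sq_nonneg (Z a ω)])
        · dsimp only
          rw [← Finset.card_univ, ← Finset.prod_const, ← Finset.prod_mul_distrib]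
          refine indicator_apply_le' (fun hω => ?_)
            (fun _ => Finset.prod_nonneg fun a _ => by positivity)
          refine Finset.one_le_prod fun a _ => ?_
          rw [← Real.exp_add]
          refine Real.one_le_exp ?_
          have := (sq_le_one_iff_abs_le_one _).2 (hω a)
          linarith
    _ ≤ D * (Real.exp (1 / 2) * (2 * Real.pi / r)) ^ Fintype.card κ := by
        rw [integral_const_mul, mul_pow, mul_left_comm]
        exact mul_le_mul_of_nonneg_left hI (by positivity)

/-- Removing the first increment (by letting its frequency tend to zero) and optimizing over the
exponents in `CondA1` yields an integrable bound for the characteristic function of the increments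
along an arithmetic progression of times. -/
theorem norm_integral_cexp_increments_le {Ω : Type*} [MeasurableSpace Ω] {P : Measure Ω}
    [IsProbabilityMeasure P] {d : ℕ} {T : ℝ} {X : ℝ → Ω → Ed d} (hmeas : ∀ t, Measurable (X t))
    {α θ : ℝ} (hA1 : CondA1 P X T α θ) (m : ℕ) :
    ∃ D : ℝ, 0 ≤ D ∧ ∀ t₀ δ : ℝ, 0 < t₀ → 0 < δ → t₀ + m * δ < T →
      ∀ ξ : Fin m → Ed d, (∀ j l, ξ j l ≠ 0) →
        ‖∫ ω, Complex.exp (Complex.I * Complex.ofReal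
          (∑ j : Fin m, ⟪ξ j, X (t₀ + (j + 1) * δ) ω - X (t₀ + j * δ) ω⟫)) ∂P‖ ≤
            D * ∏ j, ∏ l, 2 / (1 + (δ ^ α * ξ j l) ^ 2) := by
  obtain ⟨C, hC, h⟩ := hA1
  refine ⟨C ^ (m + 1) * ((m + 1 : ℕ) : ℝ) ^ (α * θ * ((m + 1 : ℕ) : ℝ)), by positivity, ?_⟩
  intro t₀ δ ht₀ hδ hT ξ hξ
  set t : Fin (m + 2) → ℝ := Fin.cons 0 fun j : Fin (m + 1) => t₀ + j * δ with ht
  have ht_zero : t 0 = 0 := rfl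
  have ht_succ (j : Fin (m + 1)) : t j.succ = t₀ + j * δ := rfl
  have ht_castSucc (j : Fin m) : t j.succ.castSucc = t₀ + j * δ := by
    rw [← Fin.succ_castSucc, ht_succ, Fin.val_castSucc]
  have hmono : StrictMono t := by
    rw [Fin.strictMono_iff_lt_succ]
    intro j
    refine Fin.cases ?_ (fun j => ?_) j
    · rw [ht_succ, Fin.castSucc_zero, ht_zero]
      simpa using ht₀
    · rw [ht_succ, ht_castSucc, Fin.val_succ]
      push_cast
      linarith
  have hlast : t (Fin.last (m + 1)) < T := by
    rw [← Fin.succ_last, ht_succ, Fin.val_last]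
    exact hT
  set k : Fin (m + 1) → Fin d → ℕ :=
    Fin.cons (fun _ => 0) fun j l => if 1 ≤ δ ^ α * |ξ j l| then 4 else 0 with hk
  have hk04 (j l) : k j l = 0 ∨ k j l = 4 := by
    refine Fin.cases (Or.inl rfl) (fun j => ?_) j
    simp only [hk, Fin.cons_succ]
    split_ifs <;> simp
  set η : ℕ → Ed d := fun n => WithLp.toLp 2 fun _ => 1 / ((n : ℝ) + 1) with hη
  have hη_lim : Tendsto η atTop (𝓝 0) := by
    refine ((PiLp.continuous_toLp 2 _).tendsto (0 : Fin d → ℝ)).comp ?_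
    exact tendsto_pi_nhds.2 fun _ => tendsto_one_div_add_atTop_nhds_zero_nat
  have hbound (n : ℕ) :
      ‖∫ ω, Complex.exp (Complex.I * Complex.ofReal (⟪η n, X t₀ ω - X 0 ω⟫ +
        ∑ j : Fin m, ⟪ξ j, X (t₀ + (j + 1) * δ) ω - X (t₀ + j * δ) ω⟫)) ∂P‖ ≤
      C ^ (m + 1) * ((m + 1 : ℕ) : ℝ) ^ (α * θ * ((m + 1 : ℕ) : ℝ)) *
        ∏ j, ∏ l, 2 / (1 + (δ ^ α * ξ j l) ^ 2) := by
    have h' := h (m + 1) m.succ_pos (Fin.cons (η n) ξ) (fun j l => by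
      refine Fin.cases ?_ (fun j => ?_) j
      · simp only [Fin.cons_zero, hη]
        positivity
      · simpa using hξ j l) t hmono ht_zero hlast k hk04
    simp only [Fin.sum_univ_succ, Fin.prod_univ_succ, ht_succ, ht_castSucc, Fin.castSucc_zero,
      ht_zero, Fin.cons_zero, Fin.cons_succ, Fin.val_succ, Fin.val_zero, hk, Nat.cast_zero,
      zero_mul, add_zero, pow_zero, mul_zero, Real.rpow_zero, inv_one, mul_one,
      Finset.prod_const_one, one_mul, Nat.cast_add, Nat.cast_one] at h'
    push_cast at h' ⊢
    refine h'.trans (mul_le_mul_of_nonneg_left ?_ (by positivity))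
    refine Finset.prod_le_prod (fun j _ => Finset.prod_nonneg fun l _ => ?_)
      fun j _ => Finset.prod_le_prod (fun l _ => ?_) fun l _ => ?_
    · have : t₀ + (j + 1) * δ - (t₀ + j * δ) = δ := by ring
      rw [this]
      positivity
    · have : t₀ + (j + 1) * δ - (t₀ + j * δ) = δ := by ring
      rw [this]
      positivity
    have hdiff : t₀ + (j + 1) * δ - (t₀ + j * δ) = δ := by ring
    rw [hdiff, ← sq_abs (δ ^ α * ξ j l), abs_mul, abs_of_pos (Real.rpow_pos_of_pos hδ α)]
    split_ifs with hu
    · rw [Real.rpow_mul hδ.le, ← mul_inv, mul_comm]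
      have hpow : (δ ^ α) ^ (4 : ℝ) = (δ ^ α) ^ 4 := by
        rw [← Real.rpow_natCast]
        norm_num
      rw [hpow, ← mul_pow, inv_eq_one_div, div_le_div_iff₀ (by positivity) (by positivity)]
      nlinarith [sq_nonneg ((δ ^ α * |ξ j l|) ^ 2 - 1), one_le_pow₀ hu (n := 2)]
    · simp only [pow_zero, mul_zero, Real.rpow_zero, inv_one, mul_one]
      rw [le_div_iff₀ (by positivity)]
      have hpos : 0 ≤ δ ^ α * |ξ j l| := by positivity
      nlinarith
  suffices hlim : Tendsto (fun n => ∫ ω, Complex.exp (Complex.I * Complex.ofReal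
      (⟪η n, X t₀ ω - X 0 ω⟫ +
        ∑ j : Fin m, ⟪ξ j, X (t₀ + (j + 1) * δ) ω - X (t₀ + j * δ) ω⟫)) ∂P) atTop
      (𝓝 (∫ ω, Complex.exp (Complex.I * Complex.ofReal
        (∑ j : Fin m, ⟪ξ j, X (t₀ + (j + 1) * δ) ω - X (t₀ + j * δ) ω⟫)) ∂P)) from
    le_of_tendsto hlim.norm (Eventually.of_forall hbound)
  refine tendsto_integral_of_dominated_convergence (fun _ => 1) (fun n => ?_)
    (integrable_const _) (fun n => ae_of_all _ fun ω => ?_) (ae_of_all _ fun ω => ?_)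
  · exact Measurable.aestronglyMeasurable (by fun_prop)
  · rw [mul_comm, Complex.norm_exp_ofReal_mul_I]
  · have hinner : Tendsto (fun n => ⟪η n, X t₀ ω - X 0 ω⟫) atTop (𝓝 0) := by
      simpa using hη_lim.inner (tendsto_const_nhds (x := X t₀ ω - X 0 ω))
    have hcont : Continuous fun x : ℝ => Complex.exp (Complex.I * Complex.ofReal (x +
        ∑ j : Fin m, ⟪ξ j, X (t₀ + (j + 1) * δ) ω - X (t₀ + j * δ) ω⟫)) := by
      fun_prop
    simpa [Function.comp_def] using (hcont.tendsto 0).comp hinner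

theorem exists_measureReal_increments_le {Ω : Type*} [MeasurableSpace Ω] {P : Measure Ω}
    [IsProbabilityMeasure P] {d : ℕ} {T : ℝ} {X : ℝ → Ω → Ed d} (hmeas : ∀ t, Measurable (X t))
    {α θ : ℝ} (hA1 : CondA1 P X T α θ) (m : ℕ) :
    ∃ D : ℝ, 0 ≤ D ∧ ∀ t₀ δ ε : ℝ, 0 < t₀ → 0 < δ → 0 < ε → t₀ + m * δ < T →
      P.real {ω | ∀ j : Fin m, ‖X (t₀ + (j + 1) * δ) ω - X (t₀ + j * δ) ω‖ ≤ ε} ≤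
        D * (ε / δ ^ α) ^ (m * d) := by
  obtain ⟨D, hD, h⟩ := norm_integral_cexp_increments_le hmeas hA1 m
  refine ⟨D * (Real.exp (1 / 2) * (2 * Real.pi)) ^ (m * d), by positivity, ?_⟩
  intro t₀ δ ε ht₀ hδ hε hT
  set Z : Fin m × Fin d → Ω → ℝ := fun a ω =>
    ε⁻¹ * (X (t₀ + (a.1 + 1) * δ) ω - X (t₀ + a.1 * δ) ω) a.2 with hZ
  have hZm (a) : Measurable (Z a) := by
    simp only [hZ, PiLp.sub_apply]
    fun_prop
  have hδα := Real.rpow_pos_of_pos hδ α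
  have key := measureReal_forall_abs_le_one_le P hZm hD (div_pos hδα hε) (fun ξ hξ => by
    have h' := h t₀ δ ht₀ hδ hT (fun j => WithLp.toLp 2 fun l => ε⁻¹ * ξ (j, l))
      (fun j l => mul_ne_zero (inv_ne_zero hε.ne') (hξ _))
    simp only [Fintype.sum_prod_type, Fintype.prod_prod_type, hZ]
    simp only [PiLp.inner_apply, RCLike.inner_apply, conj_trivial] at h'
    have hsum (x y : ℝ) : y * (ε⁻¹ * x) = x * (ε⁻¹ * y) := by ring
    have hprod (x : ℝ) : δ ^ α * (ε⁻¹ * x) = δ ^ α / ε * x := by ring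
    simpa only [hsum, hprod] using h')
  calc P.real {ω | ∀ j : Fin m, ‖X (t₀ + (j + 1) * δ) ω - X (t₀ + j * δ) ω‖ ≤ ε}
      ≤ P.real {ω | ∀ a, |Z a ω| ≤ 1} := by
        refine measureReal_mono fun ω hω a => ?_
        simp only [hZ]
        rw [abs_mul, abs_of_pos (inv_pos.2 hε), inv_mul_le_iff₀ hε, mul_one]
        exact (PiLp.norm_apply_le _ a.2).trans (hω a.1)
    _ ≤ _ := key
    _ = _ := by
        rw [Fintype.card_prod, Fintype.card_fin, Fintype.card_fin, mul_assoc D, ← mul_pow]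
        congr 2
        field_simp

/-- Near a point of differentiability, any fixed number of consecutive increments along fine
uniform grids is of the order of the mesh. -/
theorem eventually_exists_increments_le_of_tendsto_slope {E : Type*} [NormedAddCommGroup E]
    [NormedSpace ℝ E] {f : ℝ → E} {T s : ℝ} (hT : 0 < T) (hs : s ∈ Icc 0 T) {v : E}
    (h : Tendsto (fun t : ℝ => (t - s)⁻¹ • (f t - f s)) (𝓝[Icc (0 : ℝ) T \ {s}] s) (𝓝 v))
    (m : ℕ) :
    ∃ K : ℕ, ∀ᶠ n : ℕ in atTop, ∃ i ∈ Finset.range n, 0 < i ∧ i + m < n ∧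
      ∀ j : Fin m, ‖f (i * (T / n) + (j + 1) * (T / n)) - f (i * (T / n) + j * (T / n))‖ ≤
        (K + 1 : ℝ) / n := by
  obtain ⟨ρ, hρ, hball⟩ := Metric.mem_nhdsWithin_iff.1
    (h.norm.eventually (gt_mem_nhds (lt_add_one ‖v‖)))
  have hlip (t : ℝ) (ht : t ∈ Icc 0 T) (hts : |t - s| < ρ) :
      ‖f t - f s‖ ≤ (‖v‖ + 1) * |t - s| := by
    rcases eq_or_ne t s with rfl | hne
    · simp
    have hb : ‖(t - s)⁻¹ • (f t - f s)‖ < ‖v‖ + 1 :=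
      hball ⟨by rwa [Metric.mem_ball, Real.dist_eq], ht, hne⟩
    have hpos : 0 < |t - s| := abs_pos.2 (sub_ne_zero.2 hne)
    rw [norm_smul, norm_inv, Real.norm_eq_abs, inv_mul_lt_iff₀ hpos, mul_comm] at hb
    exact hb.le
  obtain ⟨K, hK⟩ := exists_nat_ge (2 * ((‖v‖ + 1) * ((m + 1) * T)))
  refine ⟨K, ?_⟩
  have hsmall : ∀ᶠ n : ℕ in atTop, (m + 1) * T / (n : ℝ) < ρ :=
    (tendsto_const_div_atTop_nhds_zero_nat ((m + 1) * T)).eventually (gt_mem_nhds hρ)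
  filter_upwards [hsmall, eventually_ge_atTop (m + 2)] with n hn hmn
  have hn0 : (0 : ℝ) < n := by
    have : 0 < n := by lia
    exact_mod_cast this
  set δ := T / n with hδ
  have hδ0 : 0 < δ := div_pos hT hn0
  have hTn : T = n * δ := by rw [hδ]; field_simp
  set q := ⌊s / δ⌋₊ with hq
  have hq1 : q * δ ≤ s := (le_div_iff₀ hδ0).1 (Nat.floor_le (div_nonneg hs.1 hδ0.le))
  have hq2 : s < (q + 1) * δ := (div_lt_iff₀ hδ0).1 (Nat.lt_floor_add_one _)
  obtain ⟨i, hi0, him, hclose⟩ : ∃ i : ℕ, 0 < i ∧ i + m < n ∧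
      ∀ j : ℕ, j ≤ m → |i * δ + j * δ - s| ≤ (m + 1) * δ := by
    by_cases hqm : q + 1 + m < n
    · refine ⟨q + 1, by lia, hqm, fun j hj => abs_le.2 ⟨?_, ?_⟩⟩
      · push_cast
        nlinarith [mul_nonneg (Nat.cast_nonneg (α := ℝ) j) hδ0.le,
          mul_nonneg (Nat.cast_nonneg (α := ℝ) m) hδ0.le]
      · push_cast
        nlinarith [mul_le_mul_of_nonneg_right (Nat.cast_le (α := ℝ).2 hj) hδ0.le]
    · obtain ⟨i, hi⟩ : ∃ i, n = i + m + 1 := ⟨n - m - 1, by lia⟩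
      have hiq : (i : ℝ) ≤ q := by
        have : i ≤ q := by lia
        exact_mod_cast this
      have hni : (n : ℝ) = i + m + 1 := by exact_mod_cast hi
      refine ⟨i, by lia, by lia, fun j hj => abs_le.2 ⟨?_, ?_⟩⟩
      · have := hs.2
        rw [hTn, hni] at this
        nlinarith [mul_nonneg (Nat.cast_nonneg (α := ℝ) j) hδ0.le]
      · nlinarith [mul_le_mul_of_nonneg_right (Nat.cast_le (α := ℝ).2 hj) hδ0.le,
          mul_le_mul_of_nonneg_right hiq hδ0.le]
  have hgrid (j : ℕ) (hj : j ≤ m) : ‖f (i * δ + j * δ) - f s‖ ≤ (‖v‖ + 1) * ((m + 1) * δ) := by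
    have hmesh : (m + 1) * δ < ρ := by rwa [hδ, ← mul_div_assoc]
    refine (hlip _ ⟨by positivity, ?_⟩ ((hclose j hj).trans_lt hmesh)).trans
      (mul_le_mul_of_nonneg_left (hclose j hj) (by positivity))
    rw [hTn, ← add_mul]
    refine mul_le_mul_of_nonneg_right ?_ hδ0.le
    have : i + j ≤ n := by lia
    exact_mod_cast this
  refine ⟨i, Finset.mem_range.2 (by lia), hi0, him, fun j => ?_⟩
  have h₁ := hgrid (j + 1) j.2
  have h₂ := hgrid j j.2.le
  push_cast at h₁
  calc ‖f (i * δ + (j + 1) * δ) - f (i * δ + j * δ)‖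
      ≤ ‖f (i * δ + (j + 1) * δ) - f s‖ + ‖f (i * δ + j * δ) - f s‖ := by
        rw [← sub_sub_sub_cancel_right _ _ (f s)]
        exact norm_sub_le _ _
    _ ≤ 2 * ((‖v‖ + 1) * ((m + 1) * T)) / n := by
        refine (add_le_add h₁ h₂).trans_eq ?_
        rw [hδ]
        ring
    _ ≤ (K + 1 : ℝ) / n := by
        gcongr
        linarith

theorem tendsto_nat_mul_const_div_rpow_pow {α T c : ℝ} (hT : 0 < T) {N : ℕ}
    (hN : 1 < (1 - α) * N) :
    Tendsto (fun n : ℕ => (n : ℝ) * (c / n / (T / n) ^ α) ^ N) atTop (𝓝 0) := by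
  have hlim : Tendsto (fun n : ℕ => (c / T ^ α) ^ N * (n : ℝ) ^ (-((1 - α) * N - 1))) atTop
      (𝓝 ((c / T ^ α) ^ N * 0)) :=
    ((tendsto_rpow_neg_atTop (sub_pos.2 hN)).comp tendsto_natCast_atTop_atTop).const_mul _
  rw [mul_zero] at hlim
  refine hlim.congr' ?_
  filter_upwards [eventually_gt_atTop 0] with n hn
  have hn0 : (0 : ℝ) < n := by exact_mod_cast hn
  have hbase : c / n / (T / n) ^ α = c / T ^ α * (n : ℝ) ^ (α - 1) := by
    rw [Real.div_rpow hT.le hn0.le, Real.rpow_sub_one hn0.ne']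
    field_simp
  have hexp : -((1 - α) * N - 1) = 1 + (α - 1) * N := by ring
  rw [hbase, mul_pow, hexp, Real.rpow_add hn0, Real.rpow_one, Real.rpow_mul_natCast hn0.le]
  ring

/-- under (A1) and (A2), almost surely the sample path `t ↦ X_t` is nowhere
differentiable on `[0,T]`: there is no `s ∈ [0,T]` and `v ∈ ℝ^d` with
`(X_t - X_s)/(t - s) → v` as `t → s` in `[0,T]`. -/
theorem samplePath_nowhere_differentiable
    {Ω : Type*} [MeasurableSpace Ω] (P : Measure Ω) [IsProbabilityMeasure P]
    {d : ℕ} (hd : 0 < d) (T : ℝ) (hT : 0 < T)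
    (X : ℝ → Ω → Ed d) (hmeas : ∀ t : ℝ, Measurable (X t))
    (hpath : ∀ᵐ ω ∂P, ContinuousOn (fun u => X u ω) (Icc 0 T))
    (α θ ι : ℝ) (hα : 0 < α) (hαd : α < 1 / d) (hθ : 0 ≤ θ) (hι : ι ∈ Icc (0 : ℝ) 1)
    (hA1 : CondA1 P X T α θ) (hA2 : CondA2 P X T α ι) :
    ∀ᵐ ω ∂P, ∀ s ∈ Icc (0 : ℝ) T, ¬ ∃ v : Ed d,
      Filter.Tendsto (fun t : ℝ => (t - s)⁻¹ • (X t ω - X s ω))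
        (𝓝[Icc (0 : ℝ) T \ {s}] s) (𝓝 v) := by
  have hd1 : (1 : ℝ) ≤ d := by exact_mod_cast hd
  have hα1 : 0 < 1 - α := by
    have : 1 / (d : ℝ) ≤ 1 := by rw [div_le_one (by linarith)]; exact hd1
    linarith
  obtain ⟨m, hm⟩ := exists_nat_gt (1 / (1 - α))
  have hmd : 1 < (1 - α) * ((m * d : ℕ) : ℝ) := by
    rw [div_lt_iff₀ hα1] at hm
    push_cast
    nlinarith [mul_nonneg (Nat.cast_nonneg (α := ℝ) m) hα1.le]
  obtain ⟨D, hD, hprob⟩ := exists_measureReal_increments_le hmeas hA1 m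
  set A : ℕ → ℕ → Set Ω := fun K n => {ω | ∃ i ∈ Finset.range n, 0 < i ∧ i + m < n ∧
    ∀ j : Fin m, ‖X (i * (T / n) + (j + 1) * (T / n)) ω - X (i * (T / n) + j * (T / n)) ω‖ ≤
      (K + 1 : ℝ) / n} with hA
  have hA_le (K n : ℕ) :
      P.real (A K n) ≤ D * (n * ((K + 1 : ℝ) / n / (T / n) ^ α) ^ (m * d)) := by
    have hsub : A K n ⊆ ⋃ i ∈ Finset.range n, {ω | 0 < i ∧ i + m < n ∧ ∀ j : Fin m,
        ‖X (i * (T / n) + (j + 1) * (T / n)) ω - X (i * (T / n) + j * (T / n)) ω‖ ≤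
          (K + 1 : ℝ) / n} := by
      rintro ω ⟨i, hi, hω⟩
      exact mem_iUnion₂.2 ⟨i, hi, hω⟩
    refine (measureReal_mono hsub (measure_ne_top _ _)).trans ((measureReal_biUnion_finset_le _ _).trans ?_)
    refine (Finset.sum_le_card_nsmul _ _
      (D * ((K + 1 : ℝ) / n / (T / n) ^ α) ^ (m * d)) fun i hi => ?_).trans_eq ?_
    · have hn0 : (0 : ℝ) < n := by exact_mod_cast (Nat.zero_le i).trans_lt (Finset.mem_range.1 hi)
      by_cases him : 0 < i ∧ i + m < n
      · simp only [him.1, him.2, true_and]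
        refine hprob _ _ _ (mul_pos (by exact_mod_cast him.1) (div_pos hT hn0)) (div_pos hT hn0)
          (by positivity) ?_
        have him' : (i : ℝ) + m < n := by exact_mod_cast him.2
        rw [← add_mul, ← mul_div_assoc, div_lt_iff₀ hn0, mul_comm]
        exact mul_lt_mul_of_pos_left him' hT
      · have : {ω | 0 < i ∧ i + m < n ∧ ∀ j : Fin m,
            ‖X (i * (T / n) + (j + 1) * (T / n)) ω - X (i * (T / n) + j * (T / n)) ω‖ ≤
              (K + 1 : ℝ) / n} = ∅ :=
          eq_empty_of_forall_notMem fun ω hω => him ⟨hω.1, hω.2.1⟩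
        rw [this, measureReal_empty]
        positivity
    · rw [Finset.card_range, nsmul_eq_mul]
      ring
  have hnull (K n₀ : ℕ) : ∀ᵐ ω ∂P, ¬ ∀ n ≥ n₀, ω ∈ A K n := by
    rw [ae_iff, ← measureReal_eq_zero_iff]
    simp only [not_not]
    have hlim := (tendsto_nat_mul_const_div_rpow_pow (c := K + 1) hT hmd).const_mul D
    rw [mul_zero] at hlim
    refine le_antisymm (ge_of_tendsto hlim ?_) measureReal_nonneg
    filter_upwards [eventually_ge_atTop n₀] with n hn
    have hsub : {ω | ∀ n ≥ n₀, ω ∈ A K n} ⊆ A K n := fun ω hω => hω n hn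
    exact (measureReal_mono hsub).trans (hA_le K n)
  filter_upwards [ae_all_iff.2 fun K => ae_all_iff.2 (hnull K)] with ω hω s hs
  rintro ⟨v, hv⟩
  obtain ⟨K, hK⟩ := eventually_exists_increments_le_of_tendsto_slope
    (f := fun t => X t ω) hT hs hv m
  obtain ⟨n₀, hn₀⟩ := eventually_atTop.1 hK
  exact hω K n₀ hn₀
end
end
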